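/- A continuum X is homeomorphic to the pseudo-arc if and only if X is hereditarily indecomposable and has span zero. -/

import Mathlib

open Set Topology

/-- A subset of a space is *regular* if it is closed and has finitely many connected
components, each of which is non-degenerate. -/
def IsRegularSet {G : Type*} [TopologicalSpace G] (A : Set G) : Prop :=
  IsClosed A ∧ {C : Set G | ∃ x ∈ A, C = connectedComponentIn A x}.Finite ∧
    ∀ x ∈ A, (connectedComponentIn A x).Nontrivial

/-- A point of a graph is *ordinary* (neither a branch point nor an endpoint) if it has an
open neighborhood homeomorphic to an open interval. -/
def IsOrdinaryPoint {G : Type*} [TopologicalSpace G] (x : G) : Prop :=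
  ∃ U : Set G, IsOpen U ∧ x ∈ U ∧ Nonempty (U ≃ₜ Set.Ioo (0 : ℝ) 1)

/-- A topological space is a *graph* if it is a finite union of arcs which intersect
at most in endpoints. -/
def IsGraphSpace (G : Type*) [TopologicalSpace G] : Prop :=
  ∃ (n : ℕ) (f : Fin n → unitInterval → G),
    (∀ i, Continuous (f i) ∧ Function.Injective (f i)) ∧
    (⋃ i, Set.range (f i)) = Set.univ ∧
    ∀ i j, i ≠ j →
      Set.range (f i) ∩ Set.range (f j) ⊆ ({f i 0, f i 1} : Set G) ∩ {f j 0, f j 1}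

/-- A subset of a space is a *graph* if it is a finite union of arcs which intersect
at most in endpoints. -/
def IsGraphSet {E : Type*} [TopologicalSpace E] (G : Set E) : Prop :=
  ∃ (n : ℕ) (f : Fin n → unitInterval → E),
    (∀ i, Continuous (f i) ∧ Function.Injective (f i)) ∧
    G = ⋃ i, Set.range (f i) ∧
    ∀ i j, i ≠ j →
      Set.range (f i) ∩ Set.range (f j) ⊆ ({f i 0, f i 1} : Set E) ∩ {f j 0, f j 1}

/-- `φ` restricted to `A` is a homeomorphism onto `B`. -/
def MapsHomeoOnto {F G : Type*} [TopologicalSpace F] [TopologicalSpace G]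
    (φ : F → G) (A : Set F) (B : Set G) : Prop :=
  φ '' A = B ∧ Topology.IsEmbedding (A.restrict φ)

/-- A *simple fold* on `G`, with pieces `F1, F2, F3` of `F` and projection `φ : F → G`,
satisfying properties (F1)-(F5). -/
def IsSimpleFold {F G : Type*} [TopologicalSpace F] [TopologicalSpace G]
    (φ : F → G) (F1 F2 F3 : Set F) : Prop :=
  Continuous φ ∧ F1 ∪ F2 ∪ F3 = Set.univ ∧
  -- (F1)
  ((φ '' F1).Nonempty ∧ (φ '' F2).Nonempty ∧ (φ '' F3).Nonempty) ∧
  (IsRegularSet (φ '' F1) ∧ IsRegularSet (φ '' F2) ∧ IsRegularSet (φ '' F3)) ∧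
  -- (F2)
  (φ '' F1) ∪ (φ '' F3) = Set.univ ∧ (φ '' F2) = (φ '' F1) ∩ (φ '' F3) ∧
  -- (F3)
  closure ((φ '' F1) \ (φ '' F2)) ∩ closure ((φ '' F3) \ (φ '' F2)) = ∅ ∧
  -- (F4)
  (MapsHomeoOnto φ F1 (φ '' F1) ∧ MapsHomeoOnto φ F2 (φ '' F2) ∧
    MapsHomeoOnto φ F3 (φ '' F3)) ∧
  -- (F5)
  frontier (φ '' F1) = φ '' (F1 ∩ F2) ∧ frontier (φ '' F3) = φ '' (F2 ∩ F3) ∧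
  F1 ∩ F3 = ∅

/-- `S` separates `A` from `B` within `Y`: the complement `Y \ S` is the union of two
disjoint sets, relatively open in `Y \ S`, containing `A` and `B` respectively. -/
def SeparatesWithin {E : Type*} [TopologicalSpace E] (Y S A B : Set E) : Prop :=
  ∃ U V : Set E,
    U ∪ V = Y \ S ∧ U ∩ V = ∅ ∧ A ⊆ U ∧ B ⊆ V ∧
    (∃ U', IsOpen U' ∧ U = (Y \ S) ∩ U') ∧ (∃ V', IsOpen V' ∧ V = (Y \ S) ∩ V')

/-- `A` has *consistent complement relative to* `B`: for each component `C` of the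
complement of `A`, either `∂C ⊆ B` or `∂C ∩ B = ∅`. -/
def ConsistentComplement {G : Type*} [TopologicalSpace G] (A B : Set G) : Prop :=
  ∀ x ∉ A, frontier (connectedComponentIn Aᶜ x) ⊆ B ∨
    frontier (connectedComponentIn Aᶜ x) ∩ B = ∅

/-- The *`A` side of `B`*, `σ_B(A)`: the closure of the union of all components of
`G \ B` meeting `A`. -/
def sideOf {G : Type*} [TopologicalSpace G] (B A : Set G) : Set G :=
  closure (⋃ x ∈ {x : G | x ∉ B ∧ (connectedComponentIn Bᶜ x ∩ A).Nonempty},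
    connectedComponentIn Bᶜ x)

/-- A subset of `G × [0,1]` is *straight* if it is closed, the projection is injective on
it, and its projection is regular. -/
def IsStraight {G : Type*} [TopologicalSpace G] (S : Set (G × unitInterval)) : Prop :=
  IsClosed S ∧ Set.InjOn Prod.fst S ∧ IsRegularSet (Prod.fst '' S)

/-- The *end set* of a straight set. -/
def endSet {G : Type*} [TopologicalSpace G] (S : Set (G × unitInterval)) :
    Set (G × unitInterval) :=
  S ∩ Prod.fst ⁻¹' (frontier (Prod.fst '' S))

/-- A *stairwell structure* of height `k` for `S ⊆ G × [0,1]`, given by the pieces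
`Sp 1, …, Sp k` with end set decompositions `E(Sp i) = α i ∪ β i`. -/
def IsStairwell {G : Type*} [TopologicalSpace G]
    (Sp α β : ℕ → Set (G × unitInterval)) (k : ℕ) (S : Set (G × unitInterval)) : Prop :=
  1 ≤ k ∧
  -- (S1)
  (∀ i ∈ Set.Icc 1 k, (Sp i).Nonempty ∧ IsStraight (Sp i)) ∧
  S = ⋃ i ∈ Set.Icc 1 k, Sp i ∧
  -- (S2)
  (∀ i ∈ Set.Icc 1 k, endSet (Sp i) = α i ∪ β i ∧ α i ∩ β i = ∅ ∧
    (α i).Finite ∧ (β i).Finite) ∧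
  α 1 = ∅ ∧ β k = ∅ ∧ (∀ i, 1 ≤ i → i < k → β i = α (i + 1)) ∧
  -- (S3)
  (∀ i, 1 ≤ i → i < k → ∃ V : Set G, IsOpen V ∧ Prod.fst '' β i ⊆ V ∧
    Prod.fst '' Sp i ∩ V = Prod.fst '' Sp (i + 1) ∩ V) ∧
  -- (S4)
  (∀ i ∈ Set.Icc 1 k, ConsistentComplement (Prod.fst '' Sp i) (Prod.fst '' α i) ∧
    ConsistentComplement (Prod.fst '' Sp i) (Prod.fst '' β i)) ∧
  -- (S5)
  (∀ i ∈ Set.Icc 2 k, ∀ p ∈ α i, IsOrdinaryPoint p.1) ∧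
  (∀ i j, 2 ≤ i → i < j → j ≤ k → Prod.fst '' α i ∩ Prod.fst '' α j = ∅)

/-- A *broken stairwell structure* of height `k` with a pit at level `i0`. -/
def IsBrokenStairwell {G : Type*} [TopologicalSpace G]
    (Sp α β : ℕ → Set (G × unitInterval)) (γ P1 P2 : Set (G × unitInterval))
    (k i0 : ℕ) (S : Set (G × unitInterval)) : Prop :=
  1 ≤ k ∧ 1 ≤ i0 ∧ i0 ≤ k ∧
  -- (S1')
  (∀ i ∈ Set.Icc 1 k, (Sp i).Nonempty ∧ IsStraight (Sp i)) ∧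
  P1.Nonempty ∧ IsStraight P1 ∧ P2.Nonempty ∧ IsStraight P2 ∧
  S = (⋃ i ∈ Set.Icc 1 k, Sp i) ∪ P1 ∪ P2 ∧
  -- (S2')
  (∀ i ∈ Set.Icc 1 k, i ≠ i0 → endSet (Sp i) = α i ∪ β i) ∧
  endSet (Sp i0) = α i0 ∪ β i0 ∪ γ ∧
  (∀ i ∈ Set.Icc 1 k, α i ∩ β i = ∅ ∧ (α i).Finite ∧ (β i).Finite) ∧
  γ.Finite ∧ α i0 ∩ γ = ∅ ∧ β i0 ∩ γ = ∅ ∧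
  α 1 = ∅ ∧ β k = ∅ ∧ (∀ i, 1 ≤ i → i < k → β i = α (i + 1)) ∧
  endSet P2 = endSet P1 ∪ γ ∧ endSet P1 ∩ γ = ∅ ∧
  -- (S3')
  (∀ i, 1 ≤ i → i < k → ∃ V : Set G, IsOpen V ∧ Prod.fst '' β i ⊆ V ∧
    Prod.fst '' Sp i ∩ V = Prod.fst '' Sp (i + 1) ∩ V) ∧
  (∃ V : Set G, IsOpen V ∧ Prod.fst '' endSet P1 ⊆ V ∧
    Prod.fst '' P1 ∩ V = Prod.fst '' P2 ∩ V) ∧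
  (∃ W : Set G, IsOpen W ∧ Prod.fst '' γ ⊆ W ∧
    Prod.fst '' P2 ∩ W = Prod.fst '' Sp i0 ∩ W) ∧
  -- (S4')
  (∀ i ∈ Set.Icc 1 k, ConsistentComplement (Prod.fst '' Sp i) (Prod.fst '' α i) ∧
    ConsistentComplement (Prod.fst '' Sp i) (Prod.fst '' β i)) ∧
  ConsistentComplement (Prod.fst '' Sp i0) (Prod.fst '' γ) ∧
  ConsistentComplement (Prod.fst '' P2) (Prod.fst '' endSet P1) ∧
  ConsistentComplement (Prod.fst '' P2) (Prod.fst '' γ) ∧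
  -- (S5')
  (∀ i ∈ Set.Icc 2 k, ∀ p ∈ α i, IsOrdinaryPoint p.1) ∧
  (∀ p ∈ endSet P1, IsOrdinaryPoint p.1) ∧ (∀ p ∈ γ, IsOrdinaryPoint p.1) ∧
  (∀ i j, 2 ≤ i → i < j → j ≤ k → Prod.fst '' α i ∩ Prod.fst '' α j = ∅) ∧
  (∀ i ∈ Set.Icc 2 k, Prod.fst '' α i ∩ Prod.fst '' endSet P1 = ∅ ∧
    Prod.fst '' α i ∩ Prod.fst '' γ = ∅) ∧
  Prod.fst '' endSet P1 ∩ Prod.fst '' γ = ∅ ∧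
  -- (S6')
  Prod.fst '' α i0 ∩ Prod.fst '' (P1 ∪ P2) = ∅

/-- A compactum is *hereditarily indecomposable* if every non-degenerate subcontinuum is
indecomposable, i.e. is not the union of two proper subcontinua. -/
def HereditarilyIndecomposable (X : Type*) [TopologicalSpace X] : Prop :=
  ∀ K : Set X, IsCompact K → IsConnected K → K.Nontrivial →
    ¬ ∃ A B : Set X, IsCompact A ∧ IsConnected A ∧ IsCompact B ∧ IsConnected B ∧
      A ∪ B = K ∧ A ≠ K ∧ B ≠ K

/-- A continuum is *arc-like* if for every `ε > 0` it admits an `ε`-map onto `[0,1]`. -/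
def ArcLike (X : Type*) [MetricSpace X] : Prop :=
  ∀ ε > (0 : ℝ), ∃ f : X → unitInterval, Continuous f ∧ Function.Surjective f ∧
    ∀ y, Metric.diam (f ⁻¹' {y}) < ε

/-- A continuum has *span zero* if every subcontinuum `Z ⊆ X × X` with
`π₁(Z) ⊆ π₂(Z)` meets the diagonal. -/
def SpanZero (X : Type*) [TopologicalSpace X] : Prop :=
  ∀ Z : Set (X × X), IsCompact Z → IsConnected Z →
    Prod.fst '' Z ⊆ Prod.snd '' Z → ∃ x, (x, x) ∈ Z

/-! ### Chains -/

theorem exists_path_of_reflTransGen {α : Type*} {r : α → α → Prop} {a b : α}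
    (h : Relation.ReflTransGen r a b) :
    ∃ (n : ℕ) (f : ℕ → α), f 0 = a ∧ f n = b ∧ ∀ i < n, r (f i) (f (i + 1)) := by
  induction h with
  | refl => exact ⟨0, fun _ => a, rfl, rfl, by simp⟩
  | @tail b c _ hbc ih =>
    obtain ⟨n, f, h0, hn, hf⟩ := ih
    refine ⟨n + 1, fun i => if i ≤ n then f i else c, by simp [h0], by simp, fun i hi => ?_⟩
    rcases Nat.lt_succ_iff_lt_or_eq.mp hi with hi | rfl
    · simpa [hi.le, Nat.succ_le_of_lt hi] using hf i hi
    · simpa [hn] using hbc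

/-- One step of length less than `δ` inside a set `Y`. -/
def StepIn {M : Type*} [MetricSpace M] (Y : Set M) (δ : ℝ) (a b : M) : Prop :=
  a ∈ Y ∧ b ∈ Y ∧ dist a b < δ

theorem StepIn.mono {M : Type*} [MetricSpace M] {Y : Set M} {δ δ' : ℝ} (h : δ ≤ δ') {a b : M}
    (hab : StepIn Y δ a b) : StepIn Y δ' a b := ⟨hab.1, hab.2.1, hab.2.2.trans_le h⟩

/-- In a compact set, points which are limits of endpoints of chains with arbitrarily small steps
lie in the same connected component. -/
theorem mem_connectedComponentIn_of_chains {M : Type*} [MetricSpace M] {Y : Set M}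
    (hY : IsCompact Y) {p q : M} (hp : p ∈ Y) (hq : q ∈ Y)
    (h : ∀ δ > 0, ∃ p' q', p' ∈ Y ∧ dist p' p < δ ∧ dist q' q < δ ∧
      Relation.ReflTransGen (StepIn Y δ) p' q') :
    q ∈ connectedComponentIn Y p := by
  have : CompactSpace Y := isCompact_iff_compactSpace.mp hY
  rw [connectedComponentIn_eq_image hp]
  refine ⟨⟨q, hq⟩, ?_, rfl⟩
  rw [connectedComponent_eq_iInter_isClopen, mem_iInter]
  rintro ⟨V, hV, hpV⟩
  obtain ⟨δ, hδ, hδV⟩ := hV.isClosed.isCompact.exists_thickening_subset_open hV.isOpen subset_rfl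
  have key : ∀ (a b : M) (ha : a ∈ Y) (hb : b ∈ Y), dist a b < δ →
      (⟨a, ha⟩ : Y) ∈ V → (⟨b, hb⟩ : Y) ∈ V := fun a b ha hb hab haV =>
    hδV (Metric.mem_thickening_iff.mpr ⟨_, haV, by rwa [dist_comm] at hab⟩)
  obtain ⟨p', q', hp', hpp, hqq, hc⟩ := h δ hδ
  have hall : ∀ b, Relation.ReflTransGen (StepIn Y δ) p' b →
      ∃ hb : b ∈ Y, (⟨b, hb⟩ : Y) ∈ V := by
    intro b hb
    induction hb with
    | refl => exact ⟨hp', key p p' hp hp' (by rwa [dist_comm]) hpV⟩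
    | tail _ hbc ih => exact ⟨hbc.2.1, key _ _ _ _ hbc.2.2 ih.2⟩
  obtain ⟨hq', hqV⟩ := hall q' hc
  exact key q' q hq' hq hqq hqV

/-! ### Hereditarily indecomposable continua of span zero -/

theorem HereditarilyIndecomposable.subset_or_subset {X : Type*} [TopologicalSpace X]
    (hX : HereditarilyIndecomposable X) {A B : Set X} (hA : IsCompact A) (hA' : IsConnected A)
    (hB : IsCompact B) (hB' : IsConnected B) (hAB : (A ∩ B).Nonempty) : A ⊆ B ∨ B ⊆ A := by
  by_contra! hcon
  have hK : (A ∪ B).Nontrivial := by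
    by_contra hs
    rw [Set.not_nontrivial_iff] at hs
    obtain ⟨x, hxA, hxB⟩ := hAB
    exact hcon.1 fun y hy => hs (Or.inl hxA) (Or.inl hy) ▸ hxB
  refine hX (A ∪ B) (hA.union hB) (hA'.union hAB hB') hK
    ⟨A, B, hA, hA', hB, hB', rfl, fun h => hcon.2 ?_, fun h => hcon.1 ?_⟩
  · rw [h]; exact subset_union_right
  · rw [h]; exact subset_union_left

/-- The set of pairs of points at distance at least `κ`. -/
def farPairs (X : Type*) [MetricSpace X] (κ : ℝ) : Set (X × X) := {z | κ ≤ dist z.1 z.2}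

theorem isCompact_farPairs (X : Type*) [MetricSpace X] [CompactSpace X] (κ : ℝ) :
    IsCompact (farPairs X κ) :=
  (isClosed_le continuous_const (continuous_fst.dist continuous_snd)).isCompact

theorem connectedComponentIn_farPairs_props {X : Type*} [MetricSpace X] [CompactSpace X] {κ : ℝ}
    {p : X × X} (hp : p ∈ farPairs X κ) :
    IsCompact (connectedComponentIn (farPairs X κ) p) ∧
      IsConnected (connectedComponentIn (farPairs X κ) p) := by
  refine ⟨?_, isConnected_connectedComponentIn_iff.mpr hp⟩
  have : CompactSpace (farPairs X κ) := isCompact_iff_compactSpace.mp (isCompact_farPairs X κ)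
  rw [connectedComponentIn_eq_image hp]
  exact isClosed_connectedComponent.isCompact.image continuous_subtype_val

theorem SpanZero.not_subset {X : Type*} [MetricSpace X] (hs : SpanZero X) {κ : ℝ} (hκ : 0 < κ)
    {Z : Set (X × X)} (hZ : IsCompact Z) (hZ' : IsConnected Z) (hsub : Z ⊆ farPairs X κ) :
    ¬ Prod.fst '' Z ⊆ Prod.snd '' Z ∧ ¬ Prod.snd '' Z ⊆ Prod.fst '' Z := by
  constructor
  · intro h
    obtain ⟨x, hx⟩ := hs Z hZ hZ' h
    have := hsub hx
    simp only [farPairs, mem_ofPred_eq, dist_self] at this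
    linarith
  · intro h
    obtain ⟨x, hx⟩ := hs (Prod.swap '' Z) (hZ.image continuous_swap)
      (hZ'.image _ continuous_swap.continuousOn) (by simpa [image_image] using h)
    obtain ⟨⟨a, b⟩, hab, he⟩ := hx
    simp only [Prod.swap_prod_mk, Prod.mk.injEq] at he
    have := hsub hab
    simp only [farPairs, mem_ofPred_eq, he.1, he.2, dist_self] at this
    linarith

/-- Chains of far pairs with small steps cannot lead from `(u, x)` to `(x, v)`. -/
theorem exists_step_no_exchange {X : Type*} [MetricSpace X] [CompactSpace X]
    (hX : HereditarilyIndecomposable X) (hs : SpanZero X) {κ : ℝ} (hκ : 0 < κ) :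
    ∃ δ > 0, ∀ u x v : X, (u, x) ∈ farPairs X κ →
      ¬ Relation.ReflTransGen (StepIn (farPairs X κ) δ) (u, x) (x, v) := by
  by_contra! hcon
  choose! u x v hux hch using fun k : ℕ => hcon (1 / ((k : ℝ) + 1)) (by positivity)
  obtain ⟨⟨u', x', v'⟩, -, φ, hφ, hlim⟩ := isCompact_univ.tendsto_subseq
    (x := fun k => (u k, x k, v k)) (fun _ => mem_univ _)
  have hu : Filter.Tendsto (fun k => u (φ k)) Filter.atTop (𝓝 u') :=
    (continuous_fst.tendsto _).comp hlim
  have hx : Filter.Tendsto (fun k => x (φ k)) Filter.atTop (𝓝 x') :=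
    ((continuous_fst.comp continuous_snd).tendsto _).comp hlim
  have hv : Filter.Tendsto (fun k => v (φ k)) Filter.atTop (𝓝 v') :=
    ((continuous_snd.comp continuous_snd).tendsto _).comp hlim
  have hclosed := (isCompact_farPairs X κ).isClosed
  have hend : ∀ k, (x k, v k) ∈ farPairs X κ := fun k => by
    rcases Relation.ReflTransGen.cases_tail (hch k) with h | ⟨b, -, h⟩
    · rw [h]; exact hux k
    · exact h.2.1
  have hp : (u', x') ∈ farPairs X κ :=
    hclosed.mem_of_tendsto (hu.prodMk_nhds hx) (Filter.Eventually.of_forall fun k => hux _)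
  have hq : (x', v') ∈ farPairs X κ :=
    hclosed.mem_of_tendsto (hx.prodMk_nhds hv) (Filter.Eventually.of_forall fun k => hend _)
  have hmem : (x', v') ∈ connectedComponentIn (farPairs X κ) (u', x') := by
    refine mem_connectedComponentIn_of_chains (isCompact_farPairs X κ) hp hq fun δ hδ => ?_
    have h1 := Metric.tendsto_nhds.mp (hu.prodMk_nhds hx) δ hδ
    have h2 := Metric.tendsto_nhds.mp (hx.prodMk_nhds hv) δ hδ
    have h3 : ∀ᶠ k in Filter.atTop, 1 / (((φ k : ℕ) : ℝ) + 1) < δ :=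
      (tendsto_one_div_add_atTop_nhds_zero_nat.comp hφ.tendsto_atTop).eventually_lt_const hδ
    obtain ⟨k, h1, h2, h3⟩ := (h1.and (h2.and h3)).exists
    exact ⟨_, _, hux (φ k), h1, h2, 
      Relation.ReflTransGen.mono (fun a b hab => hab.mono h3.le) _ _ (hch (φ k))⟩
  obtain ⟨hZ, hZ'⟩ := connectedComponentIn_farPairs_props hp
  have hne := hs.not_subset hκ hZ hZ' (connectedComponentIn_subset _ _)
  rcases hX.subset_or_subset (hZ.image continuous_fst) (hZ'.image _ continuous_fst.continuousOn)
    (hZ.image continuous_snd) (hZ'.image _ continuous_snd.continuousOn)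
    ⟨x', ⟨_, hmem, rfl⟩, ⟨_, mem_connectedComponentIn hp, rfl⟩⟩ with h | h
  exacts [hne.1 h, hne.2 h]

/-! ### A Hex-type lemma -/

/-- Adjacency in the triangulated grid. -/
def HexAdj (a b : ℕ × ℕ) : Prop :=
  (b.1 = a.1 + 1 ∧ b.2 = a.2) ∨ (a.1 = b.1 + 1 ∧ b.2 = a.2) ∨
  (b.1 = a.1 ∧ b.2 = a.2 + 1) ∨ (b.1 = a.1 ∧ a.2 = b.2 + 1) ∨
  (b.1 = a.1 + 1 ∧ b.2 = a.2 + 1) ∨ (a.1 = b.1 + 1 ∧ a.2 = b.2 + 1)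

theorem HexAdj.symm {a b : ℕ × ℕ} (h : HexAdj a b) : HexAdj b a := by
  unfold HexAdj at *
  omega

/-- Adjacency within the part of the `(p, q)`-box lying in `W`. -/
def HexStep (p q : ℕ) (W : ℕ × ℕ → Prop) (a b : ℕ × ℕ) : Prop :=
  HexAdj a b ∧ (a.1 ≤ p ∧ a.2 ≤ q ∧ W a) ∧ b.1 ≤ p ∧ b.2 ≤ q ∧ W b

theorem triangle_parity {C₁ C₂ C₃ R₁ R₂ R₃ : Prop} [Decidable C₁] [Decidable C₂] [Decidable C₃]
    [Decidable R₁] [Decidable R₂] [Decidable R₃] (x1 : C₁ → ¬ R₁) (x2 : C₂ → ¬ R₂)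
    (x3 : C₃ → ¬ R₃) (t1 : C₁ → R₂ → C₃ ∨ R₃) (t2 : C₂ → R₁ → C₃ ∨ R₃) (t3 : C₁ → R₃ → C₂ ∨ R₂)
    (t4 : C₃ → R₁ → C₂ ∨ R₂) (t5 : C₂ → R₃ → C₁ ∨ R₁) (t6 : C₃ → R₂ → C₁ ∨ R₁) :
    ((if C₁ then 1 else 0) * (if R₂ then 1 else 0) + (if R₁ then 1 else 0) * (if C₂ then 1 else 0))
    + ((if C₁ then 1 else 0) * (if R₃ then 1 else 0)
      + (if R₁ then 1 else 0) * (if C₃ then 1 else 0))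
    + ((if C₂ then 1 else 0) * (if R₃ then 1 else 0)
      + (if R₂ then 1 else 0) * (if C₃ then 1 else 0)) = (0 : ZMod 2) := by
  by_cases k1 : C₁ <;> by_cases k2 : C₂ <;> by_cases k3 : C₃ <;>
  simp only [k1, k2, k3, true_or, false_or, true_imp_iff, false_imp_iff,
    imp_true_iff, if_true, if_false] at * <;>
  by_cases l1 : R₁ <;> by_cases l2 : R₂ <;> by_cases l3 : R₃ <;>
  simp_all <;> decide

theorem edge_parity {C₁ C₂ R₁ R₂ : Prop} [Decidable C₁] [Decidable C₂] [Decidable R₁]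
    [Decidable R₂] (x1 : C₁ → ¬ R₁) (x2 : C₂ → ¬ R₂) (y1 : C₁ → C₂ ∨ R₂) (y2 : C₂ → C₁ ∨ R₁) :
    (if C₁ then 1 else 0) * (if R₂ then 1 else 0) + (if R₁ then 1 else 0) * (if C₂ then 1 else 0)
      = (if C₁ then 1 else 0) + (if C₂ then (1 : ZMod 2) else 0) := by
  by_cases k1 : C₁ <;> by_cases k2 : C₂ <;> by_cases l1 : R₁ <;> by_cases l2 : R₂ <;>
  first
  | (simp only [k1, k2, l1, l2, if_true, if_false]; decide)
  | (exfalso; tauto)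

theorem hex_parity {p q : ℕ} {c r : ℕ → ℕ → ZMod 2}
    (h1 : ∀ i < p, ∀ j < q, (c i j * r (i+1) j + r i j * c (i+1) j)
      + (c i j * r (i+1) (j+1) + r i j * c (i+1) (j+1))
      + (c (i+1) j * r (i+1) (j+1) + r (i+1) j * c (i+1) (j+1)) = 0)
    (h2 : ∀ i < p, ∀ j < q, (c i j * r i (j+1) + r i j * c i (j+1))
      + (c i j * r (i+1) (j+1) + r i j * c (i+1) (j+1))
      + (c i (j+1) * r (i+1) (j+1) + r i (j+1) * c (i+1) (j+1)) = 0)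
    (hr : ∀ j ≤ q, r 0 j = 0) (hc : ∀ j ≤ q, c p j = 0) (hcq : ∀ i ≤ p, c i q = 0)
    (h0 : c 0 0 = 1)
    (hcr : ∀ i < p, c i 0 * r (i+1) 0 + r i 0 * c (i+1) 0 = c i 0 + c (i+1) 0) :
    False := by
  have two : ∀ a : ZMod 2, a + a = 0 := CharTwo.add_self_eq_zero
  let H : ℕ → ℕ → ZMod 2 := fun n j => ∑ i ∈ Finset.range n,
    (c i j * r (i+1) j + r i j * c (i+1) j)
  let V : ℕ → ℕ → ZMod 2 := fun i j => c i j * r i (j+1) + r i j * c i (j+1)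
  have key : ∀ j < q, ∀ n ≤ p, H n j + H n (j+1) = V 0 j + V n j := by
    intro j hj n hn
    induction n with
    | zero => simp [H, two]
    | succ n ih =>
      have ih := ih (by omega)
      have e1 := h1 n (by omega) j hj
      have e2 := h2 n (by omega) j hj
      simp only [H, Finset.sum_range_succ] at ih ⊢
      simp only [V] at ih ⊢
      linear_combination ih + e1 + e2 - two (c n j * r (n+1) (j+1) + r n j * c (n+1) (j+1))
        - two (c (n+1) j * r (n+1) (j+1) + r (n+1) j * c (n+1) (j+1))
  have hstep : ∀ j < q, H p j = H p (j+1) := by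
    intro j hj
    have := key j hj p le_rfl
    simp only [V, hr j hj.le, hr (j+1) hj, hc j hj.le, hc (j+1) hj, zero_mul, mul_zero,
      add_zero] at this
    have h2' := two (H p (j+1))
    linear_combination this - h2'
  have hall : ∀ j ≤ q, H p 0 = H p j := by
    intro j hj
    induction j with
    | zero => rfl
    | succ j ih => rw [ih (by omega), hstep j (by omega)]
  have hq : H p q = 0 := Finset.sum_eq_zero fun i hi => by
    rw [Finset.mem_range] at hi
    simp [hcq i hi.le, hcq (i+1) hi]
  have hbot : ∀ n ≤ p, H n 0 = c 0 0 + c n 0 := by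
    intro n hn
    induction n with
    | zero => simp [H, two]
    | succ n ih =>
      have ih := ih (by omega)
      simp only [H, Finset.sum_range_succ] at ih ⊢
      rw [ih]
      linear_combination hcr n (by omega) + two (c n 0)
  have := hbot p le_rfl
  rw [hall q le_rfl, hq, h0, hc 0 (Nat.zero_le _)] at this
  simp at this

/-- Either the `W`-component of the origin reaches the right or the top side of the box, or
the complement of `W` joins the bottom side to the left side. -/
theorem hex_lemma (p q : ℕ) (W : ℕ × ℕ → Prop) (hW : W (0, 0)) :
    (∃ i j, Relation.ReflTransGen (HexStep p q W) (0, 0) (i, j) ∧ (i = p ∨ j = q)) ∨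
    ∃ i j, i ≤ p ∧ j ≤ q ∧ ¬ W (i, 0) ∧
      Relation.ReflTransGen (HexStep p q fun a => ¬ W a) (i, 0) (0, j) := by
  classical
  by_contra! hcon
  obtain ⟨hA, hB⟩ := hcon
  let C : ℕ → ℕ → Prop := fun i j => Relation.ReflTransGen (HexStep p q W) (0, 0) (i, j)
  let R : ℕ → ℕ → Prop := fun i j => ∃ k ≤ p, ¬ W (k, 0) ∧
    Relation.ReflTransGen (HexStep p q fun a => ¬ W a) (k, 0) (i, j)
  have hCW : ∀ i j, C i j → i ≤ p ∧ j ≤ q ∧ W (i, j) := by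
    intro i j h
    rcases Relation.ReflTransGen.cases_tail h with h | ⟨b, -, h⟩
    · cases h; exact ⟨Nat.zero_le _, Nat.zero_le _, hW⟩
    · exact h.2.2
  have hRW : ∀ i j, R i j → i ≤ p ∧ j ≤ q ∧ ¬ W (i, j) := by
    rintro i j ⟨k, hk, hkW, h⟩
    rcases Relation.ReflTransGen.cases_tail h with h | ⟨b, -, h⟩
    · cases h; exact ⟨hk, Nat.zero_le _, hkW⟩
    · exact h.2.2
  have hCs : ∀ i j i' j', C i j → HexAdj (i, j) (i', j') → i' ≤ p → j' ≤ q → W (i', j') →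
      C i' j' := fun i j i' j' h h1 h2 h3 h4 => h.tail ⟨h1, hCW i j h, h2, h3, h4⟩
  have hRs : ∀ i j i' j', R i j → HexAdj (i, j) (i', j') → i' ≤ p → j' ≤ q → ¬ W (i', j') →
      R i' j' := fun i j i' j' ⟨k, hk, hkW, h⟩ h1 h2 h3 h4 =>
        ⟨k, hk, hkW, h.tail ⟨h1, hRW i j ⟨k, hk, hkW, h⟩, h2, h3, h4⟩⟩
  let c : ℕ → ℕ → ZMod 2 := fun i j => if C i j then 1 else 0
  let r : ℕ → ℕ → ZMod 2 := fun i j => if R i j then 1 else 0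
  have exc : ∀ i j, C i j → ¬ R i j := fun i j h h' => (hRW i j h').2.2 (hCW i j h).2.2
  have hthird : ∀ i j i' j' i'' j'', HexAdj (i, j) (i'', j'') → HexAdj (i', j') (i'', j'') →
      i'' ≤ p → j'' ≤ q → C i j → R i' j' → C i'' j'' ∨ R i'' j'' := by
    intro i j i' j' i'' j'' h1 h2 h3 h4 h5 h6
    by_cases hw : W (i'', j'')
    · exact .inl (hCs _ _ _ _ h5 h1 h3 h4 hw)
    · exact .inr (hRs _ _ _ _ h6 h2 h3 h4 hw)
  have tri : ∀ i j i' j' i'' j'', i ≤ p → j ≤ q → i' ≤ p → j' ≤ q → i'' ≤ p → j'' ≤ q →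
      HexAdj (i, j) (i', j') → HexAdj (i, j) (i'', j'') → HexAdj (i', j') (i'', j'') →
      (c i j * r i' j' + r i j * c i' j') + (c i j * r i'' j'' + r i j * c i'' j'')
      + (c i' j' * r i'' j'' + r i' j' * c i'' j'') = 0 := by
    intro i j i' j' i'' j'' b1 b2 b3 b4 b5 b6 a1 a2 a3
    have t1 := hthird _ _ _ _ _ _ a2 a3 b5 b6
    have t2 := hthird _ _ _ _ _ _ a3 a2 b5 b6
    have t3 := hthird _ _ _ _ _ _ a1 a3.symm b3 b4
    have t4 := hthird _ _ _ _ _ _ a3.symm a1 b3 b4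
    have t5 := hthird _ _ _ _ _ _ a1.symm a2.symm b1 b2
    have t6 := hthird _ _ _ _ _ _ a2.symm a1.symm b1 b2
    have x1 := exc i j
    have x2 := exc i' j'
    have x3 := exc i'' j''
    exact triangle_parity x1 x2 x3 t1 t2 t3 t4 t5 t6
  refine hex_parity (p := p) (q := q) (c := c) (r := r) ?_ ?_ ?_ ?_ ?_ ?_ ?_
  · intro i hi j hj
    refine tri i j (i+1) j (i+1) (j+1) (by omega) (by omega) (by omega) (by omega) (by omega)
      (by omega) ?_ ?_ ?_ <;> simp [HexAdj]
  · intro i hi j hj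
    refine tri i j i (j+1) (i+1) (j+1) (by omega) (by omega) (by omega) (by omega) (by omega)
      (by omega) ?_ ?_ ?_ <;> simp [HexAdj]
  · intro j hj
    refine if_neg ?_
    rintro ⟨k, hk, hkW, h⟩
    exact hB k j hk hj hkW h
  · exact fun j _ => if_neg fun h => (hA p j h).1 rfl
  · exact fun i _ => if_neg fun h => (hA i q h).2 rfl
  · exact if_pos Relation.ReflTransGen.refl
  · intro i hi
    have x1 := exc i 0
    have x2 := exc (i+1) 0
    have ad : HexAdj (i, 0) (i+1, 0) := by simp [HexAdj]
    have y1 : C i 0 → C (i+1) 0 ∨ R (i+1) 0 := fun h => by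
      by_cases hw : W (i+1, 0)
      · exact .inl (hCs _ _ _ _ h ad hi (Nat.zero_le _) hw)
      · exact .inr ⟨i+1, hi, hw, .refl⟩
    have y2 : C (i+1) 0 → C i 0 ∨ R i 0 := fun h => by
      by_cases hw : W (i, 0)
      · exact .inl (hCs _ _ _ _ h ad.symm hi.le (Nat.zero_le _) hw)
      · exact .inr ⟨i, hi.le, hw, .refl⟩
    exact edge_parity x1 x2 y1 y2

/-! ### Moving along levels of constant sign -/

/-- A move between states `(x, j)`, where `f j x` is larger than `θ` in absolute value: either
the level is kept and the point moves by less than `δ`, or the point is kept and the level changes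
without passing over a level where `f` has the opposite sign. -/
def LevelMove {X : Type*} [MetricSpace X] (f : ℕ → X → ℝ) (n : ℕ) (θ δ : ℝ) (a b : X × ℕ) :
    Prop :=
  (a.2 ≤ n ∧ b.2 ≤ n ∧ θ < |f a.2 a.1| ∧ θ < |f b.2 b.1| ∧ 0 < f a.2 a.1 * f b.2 b.1) ∧
  ((a.2 = b.2 ∧ dist a.1 b.1 < δ) ∨ (a.1 = b.1 ∧
    ∀ l, (a.2 ≤ l ∧ l ≤ b.2 ∨ b.2 ≤ l ∧ l ≤ a.2) → 0 ≤ f l a.1 * f a.2 a.1))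

section LevelMove

variable {X : Type*} [MetricSpace X] {f : ℕ → X → ℝ} {n : ℕ} {θ δ κ : ℝ}

theorem LevelMove.symm {a b : X × ℕ} (h : LevelMove f n θ δ a b) : LevelMove f n θ δ b a := by
  obtain ⟨⟨h1, h2, h3, h4, h5⟩, h6⟩ := h
  refine ⟨⟨h2, h1, h4, h3, by rwa [mul_comm]⟩, ?_⟩
  rcases h6 with ⟨h6, h7⟩ | ⟨h6, h7⟩
  · exact .inl ⟨h6.symm, by rwa [dist_comm]⟩
  · refine .inr ⟨h6.symm, fun l hl => ?_⟩
    have := h7 l hl.symm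
    rw [h6] at this h5
    by_contra! hneg
    nlinarith [mul_pos h5 (neg_pos.mpr hneg), mul_nonneg this (sq_nonneg (f b.2 b.1))]

theorem LevelMove.dist_lt (hδ : 0 < δ) {a b : X × ℕ} (h : LevelMove f n θ δ a b) :
    dist a.1 b.1 < δ := by
  rcases h.2 with h | h
  · exact h.2
  · rwa [h.1, dist_self]

theorem LevelMove.pos_iff {a b : X × ℕ} (h : LevelMove f n θ δ a b) :
    0 < f a.2 a.1 ↔ 0 < f b.2 b.1 :=
  pos_iff_pos_of_mul_pos h.1.2.2.2.2

theorem LevelMove.lt_of_lt (hκ : ∀ l ≤ n, ∀ x y : X, dist x y < 2 * κ → |f l x - f l y| < θ)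
    {a a' b : X × ℕ} (h : LevelMove f n θ δ a a') (ha : θ < f a.2 a.1) (hθ : 0 < θ)
    (hb : f b.2 b.1 < -θ) (hbn : b.2 ≤ n) (hab : dist a.1 b.1 < 2 * κ) (hlt : a.2 < b.2) :
    a'.2 < b.2 := by
  rcases h.2 with h | ⟨-, h⟩
  · rwa [← h.1]
  · by_contra! hle
    have h1 := h b.2 (.inl ⟨hlt.le, hle⟩)
    have h2 := abs_lt.mp (hκ b.2 hbn _ _ hab)
    nlinarith [mul_pos (show 0 < -f b.2 a.1 by linarith) (hθ.trans ha)]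

theorem LevelMove.lt_of_lt' (hκ : ∀ l ≤ n, ∀ x y : X, dist x y < 2 * κ → |f l x - f l y| < θ)
    {a b b' : X × ℕ} (h : LevelMove f n θ δ b b') (ha : θ < f a.2 a.1) (hθ : 0 < θ)
    (hb : f b.2 b.1 < -θ) (han : a.2 ≤ n) (hab : dist a.1 b.1 < 2 * κ) (hlt : a.2 < b.2) :
    a.2 < b'.2 := by
  rcases h.2 with h | ⟨-, h⟩
  · rwa [← h.1]
  · by_contra! hle
    have h1 := h a.2 (.inr ⟨hle, hlt.le⟩)
    have h2 := abs_lt.mp (hκ a.2 han _ _ hab)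
    nlinarith [mul_pos (show 0 < f a.2 b.1 by linarith) (show 0 < -f b.2 b.1 by linarith)]

theorem levelMove_path {m : ℕ} {a : ℕ → X × ℕ} (ha : ∀ s < m, LevelMove f n θ δ (a s) (a (s + 1)))
    (h0 : (a 0).2 ≤ n ∧ θ < |f (a 0).2 (a 0).1|) : ∀ s ≤ m, (a s).2 ≤ n ∧
    θ < |f (a s).2 (a s).1| ∧ (0 < f (a s).2 (a s).1 ↔ 0 < f (a 0).2 (a 0).1) := by
  intro s hs
  induction s with
  | zero => exact ⟨h0.1, h0.2, Iff.rfl⟩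
  | succ s ih =>
    have h := ha s hs
    exact ⟨h.1.2.1, h.1.2.2.2.1, h.pos_iff.symm.trans (ih (by omega)).2.2⟩

theorem exists_uniform_modulus [CompactSpace X] (hf : ∀ j ≤ n, Continuous (f j)) (hθ : 0 < θ) :
    ∃ κ > 0, ∀ l ≤ n, ∀ x y : X, dist x y < 2 * κ → |f l x - f l y| < θ := by
  have hc : Continuous fun x (l : Fin (n + 1)) => f l x :=
    continuous_pi fun l => hf l (Nat.lt_succ_iff.mp l.2)
  obtain ⟨κ, hκ, h⟩ := Metric.uniformContinuous_iff.mp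
    (CompactSpace.uniformContinuous_of_continuous hc) θ hθ
  refine ⟨κ / 2, half_pos hκ, fun l hl x y hxy => ?_⟩
  have := (dist_pi_lt_iff hθ).mp (h (by linarith : dist x y < κ)) ⟨l, Nat.lt_succ_iff.mpr hl⟩
  rwa [Real.dist_eq] at this

/-- If a positive level lies below a negative level at the same point, it is not possible that
moves lead from the former to the top level and from the latter to the bottom level. -/
theorem exists_step_no_crossing [CompactSpace X] (hX : HereditarilyIndecomposable X)
    (hs : SpanZero X) (hf : ∀ j ≤ n, Continuous (f j)) (hθ : 0 < θ) :
    ∃ δ > 0, (∀ l ≤ n, ∀ x y : X, dist x y < δ → |f l x - f l y| < θ) ∧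
      ∀ (x : X) (i j : ℕ), i < j → j ≤ n → θ < f i x → f j x < -θ → ∀ y z : X,
        Relation.ReflTransGen (LevelMove f n θ δ) (x, i) (y, n) →
        ¬ Relation.ReflTransGen (LevelMove f n θ δ) (x, j) (z, 0) := by
  obtain ⟨κ, hκ, hmod⟩ := exists_uniform_modulus hf hθ
  obtain ⟨δ', hδ', hJ⟩ := exists_step_no_exchange hX hs hκ
  have hδ : 0 < min δ' κ := lt_min hδ' hκ
  refine ⟨min δ' κ, hδ, fun l hl x y hxy => hmod l hl x y ?_, ?_⟩
  · linarith [min_le_right δ' κ]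
  intro x i j hij hjn hi hj y z hpa hpb
  obtain ⟨p, a, a0, ap, ha⟩ := exists_path_of_reflTransGen hpa
  obtain ⟨q, b, b0, bq, hb⟩ := exists_path_of_reflTransGen hpb
  have hA := levelMove_path ha (by rw [a0]; exact ⟨by simp; omega, hi.trans_le (le_abs_self _)⟩)
  have hB := levelMove_path hb
    (by rw [b0]; exact ⟨hjn, by rw [lt_abs]; right; simp only; linarith⟩)
  simp only [a0, b0, hθ.trans hi, (by linarith : ¬ 0 < f j x), iff_true, iff_false, not_lt] at hA hB
  have hA' : ∀ s ≤ p, θ < f (a s).2 (a s).1 := fun s hs => by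
    have := hA s hs
    rw [abs_of_pos this.2.2] at this; exact this.2.1
  have hB' : ∀ s ≤ q, f (b s).2 (b s).1 < -θ := fun s hs => by
    have := hB s hs
    rw [abs_of_nonpos this.2.2] at this; linarith [this.2.1]
  have hstepa : ∀ s s', s ≤ p → s' ≤ p → (s' = s ∨ s' = s + 1 ∨ s = s' + 1) →
      a s' = a s ∨ LevelMove f n θ (min δ' κ) (a s) (a s') := by
    rintro s s' h h' (rfl | rfl | rfl)
    exacts [.inl rfl, .inr (ha _ h'), .inr (ha _ h).symm]
  have hstepb : ∀ s s', s ≤ q → s' ≤ q → (s' = s ∨ s' = s + 1 ∨ s = s' + 1) →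
      b s' = b s ∨ LevelMove f n θ (min δ' κ) (b s) (b s') := by
    rintro s s' h h' (rfl | rfl | rfl)
    exacts [.inl rfl, .inr (hb _ h'), .inr (hb _ h).symm]
  have hda : ∀ s s', s ≤ p → s' ≤ p → (s' = s ∨ s' = s + 1 ∨ s = s' + 1) →
      dist (a s).1 (a s').1 < min δ' κ := fun s s' h h' hss => by
    rcases hstepa s s' h h' hss with h | h
    · rwa [h, dist_self]
    · exact h.dist_lt hδ
  have hdb : ∀ s s', s ≤ q → s' ≤ q → (s' = s ∨ s' = s + 1 ∨ s = s' + 1) →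
      dist (b s).1 (b s').1 < min δ' κ := fun s s' h h' hss => by
    rcases hstepb s s' h h' hss with h | h
    · rwa [h, dist_self]
    · exact h.dist_lt hδ
  have hadj : ∀ {u v : ℕ × ℕ}, HexAdj u v → (v.1 = u.1 ∨ v.1 = u.1 + 1 ∨ u.1 = v.1 + 1) ∧
      (v.2 = u.2 ∨ v.2 = u.2 + 1 ∨ u.2 = v.2 + 1) := by
    intro u v h; unfold HexAdj at h; omega
  rcases hex_lemma p q (fun st => dist (a st.1).1 (b st.2).1 < κ) (by simpa [a0, b0]) with
    ⟨s, t, hst, hend⟩ | ⟨s, t, hs, ht, hW, hst⟩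
  · have main : ∀ st : ℕ × ℕ, Relation.ReflTransGen
        (HexStep p q fun st => dist (a st.1).1 (b st.2).1 < κ) (0, 0) st →
        st.1 ≤ p ∧ st.2 ≤ q ∧ (a st.1).2 < (b st.2).2 := by
      intro st h
      induction h with
      | refl => simpa [a0, b0]
      | @tail u v _ huv ih =>
        obtain ⟨h1, ⟨h2, h3, h4⟩, h5, h6, h7⟩ := huv
        obtain ⟨g1, g2⟩ := hadj h1
        refine ⟨h5, h6, ?_⟩
        have hd := hda _ _ h2 h5 g1
        have hmid : dist (a v.1).1 (b u.2).1 < 2 * κ := by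
          have := dist_triangle_left (a v.1).1 (b u.2).1 (a u.1).1
          have := min_le_right δ' κ
          linarith
        have hm : (a v.1).2 < (b u.2).2 := by
          rcases hstepa _ _ h2 h5 g1 with h | h
          · rw [h]; exact ih.2.2
          · exact h.lt_of_lt hmod (hA' _ h2) hθ (hB' _ h3) (hB _ h3).1 (by linarith)
              ih.2.2
        rcases hstepb _ _ h3 h6 g2 with h | h
        · rwa [h]
        · exact h.lt_of_lt' hmod (hA' _ h5) hθ (hB' _ h3) (hA _ h5).1 hmid hm
    obtain ⟨h1, h2, h3⟩ := main _ hst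
    rcases hend with rfl | rfl
    · have := (hB t h2).1
      simp only [ap] at h3
      omega
    · simp [bq] at h3
  · have hchain : Relation.ReflTransGen (StepIn (farPairs X κ) δ') ((a s).1, (b 0).1)
        ((a 0).1, (b t).1) := by
      refine Relation.ReflTransGen.lift (r := HexStep p q fun st => ¬ dist (a st.1).1 (b st.2).1 < κ)
        (fun st : ℕ × ℕ => ((a st.1).1, (b st.2).1)) ?_ _ _ hst
      intro u v ⟨h1, ⟨h2, h3, h4⟩, h5, h6, h7⟩
      obtain ⟨g1, g2⟩ := hadj h1
      refine ⟨not_lt.mp h4, not_lt.mp h7, ?_⟩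
      rw [Prod.dist_eq]
      exact max_lt ((hda _ _ h2 h5 g1).trans_le (min_le_left _ _))
        ((hdb _ _ h3 h6 g2).trans_le (min_le_left _ _))
    have hf : ((a s).1, (b 0).1) ∈ farPairs X κ := not_lt.mp hW
    rw [a0, b0] at *
    exact hJ _ _ _ hf hchain

end LevelMove

/-! ### Counting sign changes -/

/-- One plus the number of sign changes among the first `n + 1` terms of a sequence starting with
a negative term. -/
noncomputable def signCount (s : ℕ → ℝ) : ℕ → ℕ
  | 0 => 1
  | j + 1 => if (Odd (signCount s j) ∧ 0 < s (j + 1)) ∨ (Even (signCount s j) ∧ s (j + 1) < 0)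
      then signCount s j + 1 else signCount s j

section signCount

variable {s : ℕ → ℝ}

theorem signCount_succ (s : ℕ → ℝ) (j : ℕ) :
    (signCount s (j + 1) = signCount s j + 1 ∧
      ((Odd (signCount s j) ∧ 0 < s (j + 1)) ∨ (Even (signCount s j) ∧ s (j + 1) < 0))) ∨
    (signCount s (j + 1) = signCount s j ∧ (Odd (signCount s j) → s (j + 1) ≤ 0) ∧
      (Even (signCount s j) → 0 ≤ s (j + 1))) := by
  by_cases h : (Odd (signCount s j) ∧ 0 < s (j + 1)) ∨ (Even (signCount s j) ∧ s (j + 1) < 0)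
  · exact .inl ⟨by rw [signCount, if_pos h], h⟩
  · refine .inr ⟨by rw [signCount, if_neg h], ?_⟩
    push Not at h
    exact h

theorem monotone_signCount (s : ℕ → ℝ) : Monotone (signCount s) :=
  monotone_nat_of_le_succ fun j => by rcases signCount_succ s j with h | h <;> omega

theorem signCount_odd {j : ℕ} (hj : s j < 0) : Odd (signCount s j) := by
  cases j with
  | zero => simp [signCount]
  | succ j =>
    rcases signCount_succ s j with ⟨h, ⟨-, h'⟩ | ⟨h', -⟩⟩ | ⟨h, -, h'⟩
    · linarith
    · rw [h]; exact h'.add_one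
    · rw [h]
      by_contra hc
      linarith [h' (Nat.not_odd_iff_even.mp hc)]

theorem signCount_even (h0 : s 0 < 0) {j : ℕ} (hj : 0 < s j) : Even (signCount s j) := by
  cases j with
  | zero => linarith
  | succ j =>
    rcases signCount_succ s j with ⟨h, ⟨h', -⟩ | ⟨-, h'⟩⟩ | ⟨h, h', -⟩
    · rw [h]; exact h'.add_one
    · linarith
    · rw [h]
      by_contra hc
      linarith [h' (Nat.not_even_iff_odd.mp hc)]

theorem signCount_lt (h0 : s 0 < 0) {i j : ℕ} (hij : i ≤ j) (h : s i * s j < 0) :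
    signCount s i < signCount s j := by
  refine (monotone_signCount s hij).lt_of_ne fun he => ?_
  rcases mul_neg_iff.mp h with ⟨h1, h2⟩ | ⟨h1, h2⟩
  · exact Nat.not_even_iff_odd.mpr (signCount_odd h2) (he ▸ signCount_even h0 h1)
  · exact Nat.not_even_iff_odd.mpr (signCount_odd h1) (he ▸ signCount_even h0 h2)

theorem mul_neg_of_mul_neg_of_mul_pos {a b a' b' : ℝ} (h : a' * b' < 0)
    (h' : 0 < a' * a * (b' * b)) : a * b < 0 := by
  by_contra! hc
  linarith [mul_nonpos_of_nonpos_of_nonneg h.le hc, mul_mul_mul_comm a' a b' b]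

theorem mul_pos_of_mul_neg_of_mul_neg {a b a' b' : ℝ} (h : a' * b' < 0)
    (h' : a' * a * (b' * b) < 0) : 0 < a * b := by
  by_contra! hc
  linarith [mul_nonneg_of_nonpos_of_nonpos h.le hc, mul_mul_mul_comm a' a b' b]

/-- Flipping the sign of some of the terms decreases the number of sign changes, when terms of the
same sign which are treated differently are separated by a term of opposite sign, and no positive
term occurs before a negative one among those which are not flipped. -/
theorem signCount_le_of_flip {s s' : ℕ → ℝ} {n : ℕ} {F : ℕ → Prop} (h0 : s 0 < 0) (h0' : s' 0 < 0)
    (hF : ∀ j ≤ n, s' j ≠ 0 → F j → s' j * s j < 0)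
    (hF' : ∀ j ≤ n, s' j ≠ 0 → ¬ F j → 0 < s' j * s j)
    (hsep : ∀ i j, i < j → j ≤ n → s' i ≠ 0 → s' j ≠ 0 → 0 < s i * s j → ¬ (F i ↔ F j) →
      ∃ l, i < l ∧ l < j ∧ s l * s i < 0)
    (hpl : ∀ i j, i < j → j ≤ n → 0 < s' i → s' j < 0 → ¬ F i → ¬ F j → False) :
    signCount s' n ≤ max 2 (signCount s n - 1) := by
  have main : ∀ j ≤ n, ∃ i ≤ j, s' i ≠ 0 ∧ (Odd (signCount s' j) ↔ s' i < 0) ∧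
      (F i → signCount s' j + 1 ≤ signCount s i) ∧
      (¬ F i → signCount s' j + 1 ≤ signCount s i ∨
        signCount s' j ≤ 2 ∧ signCount s' j ≤ signCount s i) := by
    intro j hj
    induction j with
    | zero =>
      refine ⟨0, le_rfl, h0'.ne, by simp [signCount, h0'], fun h => ?_, fun _ => ?_⟩
      · exact absurd (mul_pos_of_neg_of_neg h0' h0) (hF 0 hj h0'.ne h).not_gt
      · simp [signCount]
    | succ j ih =>
      obtain ⟨i, hij, hi, hodd, h1, h2⟩ := ih (by omega)
      rcases signCount_succ s' j with ⟨hc, hk⟩ | ⟨hc, -⟩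
      swap
      · exact ⟨i, by omega, hi, by rwa [hc], by rwa [hc], by rwa [hc]⟩
      have hik : i < j + 1 := by omega
      have hopp : s' i * s' (j + 1) < 0 := by
        rcases hk with ⟨hk, hk'⟩ | ⟨hk, hk'⟩
        · exact mul_neg_of_neg_of_pos (hodd.mp hk) hk'
        · refine mul_neg_of_pos_of_neg (lt_of_le_of_ne ?_ hi.symm) hk'
          rw [← not_lt, ← hodd]
          exact Nat.not_odd_iff_even.mpr hk
      have hk0 : s' (j + 1) ≠ 0 := right_ne_zero_of_mul hopp.ne
      have two : 0 < s i * s (j + 1) → ¬ (F i ↔ F (j + 1)) →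
          signCount s i + 2 ≤ signCount s (j + 1) := by
        intro hpos hne
        obtain ⟨l, hl1, hl2, hl⟩ := hsep i (j + 1) hik hj hi hk0 hpos hne
        have e1 := signCount_lt h0 hl1.le (by rwa [mul_comm])
        have e2 := signCount_lt h0 hl2.le (mul_neg_of_mul_neg_of_mul_pos (a' := s l) (b' := s i) hl
          (mul_pos (mul_self_pos.mpr (left_ne_zero_of_mul hl.ne)) hpos))
        omega
      have same : (F i → ¬ F (j + 1)) → (¬ F i → F (j + 1)) → 0 < s i * s (j + 1) := by
        intro g1 g2
        by_cases g : F i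
        · exact mul_pos_of_mul_neg_of_mul_neg hopp
            (mul_neg_of_neg_of_pos (hF i (by omega) hi g) (hF' _ hj hk0 (g1 g)))
        · exact mul_pos_of_mul_neg_of_mul_neg hopp
            (mul_neg_of_pos_of_neg (hF' i (by omega) hi g) (hF _ hj hk0 (g2 g)))
      have diff : (F i ↔ F (j + 1)) → s i * s (j + 1) < 0 := by
        intro g1
        by_cases g : F i
        · exact mul_neg_of_mul_neg_of_mul_pos hopp
            (mul_pos_of_neg_of_neg (hF i (by omega) hi g) (hF _ hj hk0 (g1.mp g)))
        · exact mul_neg_of_mul_neg_of_mul_pos hopp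
            (mul_pos (hF' i (by omega) hi g) (hF' _ hj hk0 fun h => g (g1.mpr h)))
      refine ⟨j + 1, le_rfl, hk0, ?_, ?_, ?_⟩
      · rw [hc, Nat.odd_add_one]
        rcases hk with ⟨hk, hk'⟩ | ⟨hk, hk'⟩
        · simp [hk, hk'.le]
        · simp [hk, hk']
      · intro hFk
        by_cases hFi : F i
        · have := signCount_lt h0 hik.le (diff (iff_of_true hFi hFk))
          have := h1 hFi
          omega
        · have := two (same (absurd · hFi) fun _ => hFk) fun h => hFi (h.mpr hFk)
          have := h2 hFi
          omega
      · intro hFk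
        by_cases hFi : F i
        · have := two (same (fun _ => hFk) (absurd hFi)) fun h => hFk (h.mp hFi)
          have := h1 hFi
          omega
        · have hlt := signCount_lt h0 hik.le (diff (iff_of_false hFi hFk))
          rcases h2 hFi with h2 | ⟨h2, h3⟩
          · omega
          · rcases hk with ⟨hk, hk'⟩ | ⟨hk, hk'⟩
            · obtain ⟨m, hm⟩ := hk
              omega
            · exact (hpl i (j + 1) hik hj (pos_of_mul_neg_left hopp hk'.le) hk' hFi hFk).elim
  obtain ⟨i, hi, -, -, h1, h2⟩ := main n le_rfl
  have := monotone_signCount s hi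
  by_cases hFi : F i
  · have := h1 hFi
    omega
  · have := h2 hFi
    omega

end signCount

/-! ### Removing islands -/

/-- Soft thresholding. -/
noncomputable def softThreshold (θ t : ℝ) : ℝ := t - max (-θ) (min t θ)

section softThreshold

variable {θ t : ℝ}

theorem continuous_softThreshold (θ : ℝ) : Continuous (softThreshold θ) := by
  unfold softThreshold; fun_prop

theorem softThreshold_of_le (h : |t| ≤ θ) : softThreshold θ t = 0 := by
  obtain ⟨h1, h2⟩ := abs_le.mp h
  rw [softThreshold, min_eq_left h2, max_eq_right h1, sub_self]

theorem softThreshold_of_pos (hθ : 0 ≤ θ) (h : θ ≤ t) : softThreshold θ t = t - θ := by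
  rw [softThreshold, min_eq_right h, max_eq_right (by linarith)]

theorem softThreshold_of_neg (hθ : 0 ≤ θ) (h : t ≤ -θ) : softThreshold θ t = t + θ := by
  rw [softThreshold, min_eq_left (by linarith), max_eq_left h]; ring

theorem softThreshold_mul_pos (hθ : 0 ≤ θ) (h : θ < |t|) : 0 < softThreshold θ t * t := by
  rcases lt_abs.mp h with h | h
  · rw [softThreshold_of_pos hθ h.le]
    exact mul_pos (by linarith) (by linarith)
  · rw [softThreshold_of_neg hθ (by linarith)]
    exact mul_pos_of_neg_of_neg (by linarith) (by linarith)

theorem softThreshold_ne_zero (hθ : 0 ≤ θ) : softThreshold θ t ≠ 0 ↔ θ < |t| := by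
  refine ⟨fun h => ?_, fun h => left_ne_zero_of_mul (softThreshold_mul_pos hθ h).ne'⟩
  by_contra! hc
  exact h (softThreshold_of_le hc)

theorem abs_le_abs_softThreshold_add (hθ : 0 ≤ θ) : |t| ≤ |softThreshold θ t| + θ := by
  have : |max (-θ) (min t θ)| ≤ θ :=
    abs_le.mpr ⟨le_max_left _ _, max_le (by linarith) (min_le_right _ _)⟩
  calc |t| = |softThreshold θ t + max (-θ) (min t θ)| := by rw [softThreshold]; ring_nf
    _ ≤ _ := (abs_add_le _ _).trans (by linarith)

end softThreshold

theorem continuous_sign_mul {X : Type*} [MetricSpace X] {e g : X → ℝ} (hg : Continuous g)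
    (he : ∀ x, |e x| = 1) {δ : ℝ} (hδ : 0 < δ)
    (h : ∀ x y, dist x y < δ → g x ≠ 0 → g y ≠ 0 → e x = e y) :
    Continuous fun x => e x * g x := by
  rw [continuous_iff_continuousAt]
  intro x
  by_cases hx : g x = 0
  · have : Filter.Tendsto (fun y => |g y|) (𝓝 x) (𝓝 0) := by
      simpa [hx] using hg.abs.tendsto x
    rw [ContinuousAt, hx, mul_zero]
    refine squeeze_zero_norm (fun y => ?_) this
    rw [norm_mul, Real.norm_eq_abs, he, one_mul, Real.norm_eq_abs]
  · refine ContinuousAt.congr (f := fun y => e x * g y)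
      (continuous_const.mul hg).continuousAt ?_
    filter_upwards [hg.continuousAt.eventually_ne hx, Metric.ball_mem_nhds x hδ] with y h1 h2
    rw [h x y (by rwa [dist_comm]) hx h1]

theorem exists_pos_lower_bound {X : Type*} [TopologicalSpace X] [CompactSpace X] [Nonempty X]
    {g : X → ℝ} (hg : Continuous g) (h : ∀ x, 0 < g x) : ∃ m > 0, ∀ x, m < g x := by
  obtain ⟨x₀, -, hx₀⟩ := isCompact_univ.exists_isMinOn univ_nonempty hg.continuousOn
  exact ⟨g x₀ / 2, half_pos (h x₀), fun x => (half_lt_self (h x₀)).trans_le (hx₀ (mem_univ x))⟩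

/-- An island is a state from which neither the bottom nor the top level can be reached. -/
def IsIsland {X : Type*} [MetricSpace X] (f : ℕ → X → ℝ) (n : ℕ) (θ δ : ℝ) (a : X × ℕ) : Prop :=
  ∀ y, ¬ Relation.ReflTransGen (LevelMove f n θ δ) a (y, 0) ∧
    ¬ Relation.ReflTransGen (LevelMove f n θ δ) a (y, n)

section IsIsland

variable {X : Type*} [MetricSpace X] {f : ℕ → X → ℝ} {n : ℕ} {θ δ : ℝ}

theorem LevelMove.isIsland_iff {a b : X × ℕ} (h : LevelMove f n θ δ a b) :
    IsIsland f n θ δ a ↔ IsIsland f n θ δ b :=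
  ⟨fun H y => ⟨fun h' => (H y).1 (h'.head h), fun h' => (H y).2 (h'.head h)⟩,
    fun H y => ⟨fun h' => (H y).1 (h'.head h.symm), fun h' => (H y).2 (h'.head h.symm)⟩⟩

theorem LevelMove.pos_iff_of_reflTransGen {a b : X × ℕ}
    (h : Relation.ReflTransGen (LevelMove f n θ δ) a b) : 0 < f a.2 a.1 ↔ 0 < f b.2 b.1 := by
  induction h with
  | refl => rfl
  | tail _ h ih => exact ih.trans h.pos_iff

open Classical in
/-- The result of thresholding and reversing the sign on islands. -/
noncomputable def flipIslands (f : ℕ → X → ℝ) (n : ℕ) (θ δ : ℝ) (j : ℕ) (x : X) : ℝ :=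
  (if IsIsland f n θ δ (x, j) then -1 else 1) * softThreshold θ (f j x)

theorem flipIslands_of_isIsland {x : X} {j : ℕ} (h : IsIsland f n θ δ (x, j)) :
    flipIslands f n θ δ j x = -softThreshold θ (f j x) := by
  rw [flipIslands, if_pos h, neg_one_mul]

theorem flipIslands_of_not_isIsland {x : X} {j : ℕ} (h : ¬ IsIsland f n θ δ (x, j)) :
    flipIslands f n θ δ j x = softThreshold θ (f j x) := by
  rw [flipIslands, if_neg h, one_mul]

theorem abs_flipIslands (x : X) (j : ℕ) : |flipIslands f n θ δ j x| = |softThreshold θ (f j x)| := by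
  rw [flipIslands, abs_mul]
  split_ifs <;> simp

theorem flipIslands_ne_zero (hθ : 0 ≤ θ) {x : X} {j : ℕ} :
    flipIslands f n θ δ j x ≠ 0 ↔ θ < |f j x| := by
  rw [← softThreshold_ne_zero hθ, ← abs_ne_zero, abs_flipIslands, abs_ne_zero]

end IsIsland

theorem exists_fewer_sign_changes {X : Type*} [MetricSpace X] [CompactSpace X] [Nonempty X]
    (hX : HereditarilyIndecomposable X) (hs : SpanZero X) {n : ℕ} {f : ℕ → X → ℝ}
    (hf : ∀ j ≤ n, Continuous (f j)) (h0 : ∀ x, f 0 x < 0) (hn : ∀ x, 0 < f n x)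
    (hadj : ∀ j < n, ∀ x, 0 ≤ f j x * f (j + 1) x) {ε : ℝ} (hε : 0 < ε) :
    ∃ f' : ℕ → X → ℝ, (∀ j ≤ n, Continuous (f' j)) ∧ (∀ x, f' 0 x < 0) ∧ (∀ x, 0 < f' n x) ∧
      (∀ j < n, ∀ x, 0 ≤ f' j x * f' (j + 1) x) ∧ (∀ j x, |f j x| ≤ |f' j x| + ε) ∧
      ∀ x, signCount (f' · x) n ≤ max 2 (signCount (f · x) n - 1) := by
  obtain ⟨m0, hm0, hm0'⟩ := exists_pos_lower_bound (hf 0 (Nat.zero_le n)).neg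
    fun x => neg_pos.mpr (h0 x)
  obtain ⟨m1, hm1, hm1'⟩ := exists_pos_lower_bound (hf n le_rfl) hn
  obtain ⟨θ, hθ, hθm⟩ := exists_between (lt_min hε (lt_min hm0 hm1))
  obtain ⟨hθε, hθ0, hθn⟩ : θ < ε ∧ θ < m0 ∧ θ < m1 := by simpa using hθm
  obtain ⟨δ, hδ, hmod, hpl⟩ := exists_step_no_crossing hX hs hf hθ
  have hisl : ∀ j ≤ n, ∀ x y, dist x y < δ → θ < |f j x| → θ < |f j y| →
      (IsIsland f n θ δ (x, j) ↔ IsIsland f n θ δ (y, j)) := by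
    intro j hj x y hxy h1 h2
    refine LevelMove.isIsland_iff ⟨⟨hj, hj, h1, h2, ?_⟩, .inl ⟨rfl, hxy⟩⟩
    have := abs_lt.mp (hmod j hj x y hxy)
    rcases lt_abs.mp h1 with h1 | h1 <;> rcases lt_abs.mp h2 with h2 | h2
    · exact mul_pos (by linarith) (by linarith)
    · linarith
    · linarith
    · exact mul_pos_of_neg_of_neg (by linarith) (by linarith)
  have hisl' : ∀ x i j, i < j → j ≤ n → θ < |f i x| → θ < |f j x| → 0 < f i x * f j x →
      (∀ l, i < l → l < j → 0 ≤ f l x * f i x) →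
      (IsIsland f n θ δ (x, i) ↔ IsIsland f n θ δ (x, j)) := by
    intro x i j hij hj h1 h2 h3 h4
    refine LevelMove.isIsland_iff ⟨⟨hij.le.trans hj, hj, h1, h2, h3⟩, .inr ⟨rfl, fun l hl => ?_⟩⟩
    rcases eq_or_ne l i with rfl | hli
    · exact mul_self_nonneg _
    rcases eq_or_ne l j with rfl | hlj
    · rw [mul_comm]; exact h3.le
    · exact h4 l (by omega) (by omega)
  have hnot0 : ∀ x, ¬ IsIsland f n θ δ (x, 0) := fun x H => (H x).1 .refl
  have hnotn : ∀ x, ¬ IsIsland f n θ δ (x, n) := fun x H => (H x).2 .refl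
  have hneg : ∀ x, flipIslands f n θ δ 0 x < 0 := fun x => by
    have : m0 < -f 0 x := hm0' x
    rw [flipIslands_of_not_isIsland (hnot0 x), softThreshold_of_neg hθ.le (by linarith)]
    linarith
  refine ⟨flipIslands f n θ δ, fun j hj => ?_, hneg, fun x => ?_, fun j hj x => ?_, fun j x => ?_,
    fun x => ?_⟩
  · refine continuous_sign_mul ((continuous_softThreshold θ).comp (hf j hj))
      (fun x => ?_) hδ fun x y hxy h1 h2 => ?_
    · split_ifs <;> simp
    · classical
      exact if_congr (hisl j hj x y hxy ((softThreshold_ne_zero hθ.le).mp h1)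
        ((softThreshold_ne_zero hθ.le).mp h2)) rfl rfl
  · have := hm1' x
    rw [flipIslands_of_not_isIsland (hnotn x), softThreshold_of_pos hθ.le (by linarith)]
    linarith
  · by_contra! hc
    have e1 := (flipIslands_ne_zero hθ.le).mp (left_ne_zero_of_mul hc.ne)
    have e2 := (flipIslands_ne_zero hθ.le).mp (right_ne_zero_of_mul hc.ne)
    have e3 : 0 < f j x * f (j + 1) x := (hadj j hj x).lt_of_ne'
      (mul_ne_zero (abs_pos.mp (hθ.trans e1)) (abs_pos.mp (hθ.trans e2)))
    have g1 := softThreshold_mul_pos hθ.le e1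
    have g2 := softThreshold_mul_pos hθ.le e2
    have e4 : 0 < softThreshold θ (f j x) * softThreshold θ (f (j + 1) x) := by
      by_contra! hc'
      nlinarith [mul_pos g1 g2, mul_nonpos_of_nonpos_of_nonneg hc' e3.le]
    have := hisl' x j (j + 1) (by omega) hj e1 e2 e3 (by omega)
    by_cases hI : IsIsland f n θ δ (x, j)
    · rw [flipIslands_of_isIsland hI, flipIslands_of_isIsland (this.mp hI)] at hc
      linarith
    · rw [flipIslands_of_not_isIsland hI, flipIslands_of_not_isIsland fun h => hI (this.mpr h)] at hc
      linarith
  · rw [abs_flipIslands]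
    linarith [abs_le_abs_softThreshold_add hθ.le (t := f j x)]
  · refine signCount_le_of_flip (F := fun j => IsIsland f n θ δ (x, j)) (h0 x) (hneg x) ?_ ?_ ?_ ?_
    · intro j hj h1 h2
      have := softThreshold_mul_pos hθ.le ((flipIslands_ne_zero hθ.le).mp h1)
      simp only [flipIslands_of_isIsland h2]
      linarith
    · intro j hj h1 h2
      have := softThreshold_mul_pos hθ.le ((flipIslands_ne_zero hθ.le).mp h1)
      simpa only [flipIslands_of_not_isIsland h2]
    · intro i j hij hj h1 h2 h3 h4
      by_contra! hc
      exact h4 (hisl' x i j hij hj ((flipIslands_ne_zero hθ.le).mp h1)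
        ((flipIslands_ne_zero hθ.le).mp h2) h3 hc)
    · intro i j hij hj h1 h2 h3 h4
      have k1 := (flipIslands_ne_zero hθ.le).mp h1.ne'
      have k2 := (flipIslands_ne_zero hθ.le).mp h2.ne
      have g1 := softThreshold_mul_pos hθ.le k1
      have g2 := softThreshold_mul_pos hθ.le k2
      rw [flipIslands_of_not_isIsland h3] at h1
      rw [flipIslands_of_not_isIsland h4] at h2
      have p1 : 0 < f i x := pos_of_mul_pos_right g1 h1.le
      have p2 : f j x < 0 := by
        by_contra! hc
        linarith [mul_nonpos_of_nonpos_of_nonneg h2.le hc]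
      rw [abs_of_pos p1] at k1
      rw [abs_of_neg p2] at k2
      simp only [IsIsland, not_forall, not_and_or, not_not] at h3 h4
      obtain ⟨y, hy⟩ := h3
      obtain ⟨z, hz⟩ := h4
      have hy := hy.resolve_left fun h =>
        (h0 y).not_gt ((LevelMove.pos_iff_of_reflTransGen h).mp p1)
      have hz := hz.resolve_right fun h =>
        p2.not_gt ((LevelMove.pos_iff_of_reflTransGen h).mpr (hn z))
      exact hpl x i j hij hj k1 (by linarith) y z hy hz

/-! ### Following the zeros of a family of functions -/

theorem one_le_signCount (s : ℕ → ℝ) (j : ℕ) : 1 ≤ signCount s j :=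
  (monotone_signCount s (Nat.zero_le j)).trans' (by simp [signCount])

theorem signCount_le (s : ℕ → ℝ) (j : ℕ) : signCount s j ≤ j + 1 := by
  induction j with
  | zero => simp [signCount]
  | succ j ih => rcases signCount_succ s j with h | h <;> omega

theorem sum_Icc_boole_le {d n : ℕ} (h : d ≤ n) :
    ∑ j ∈ Finset.Icc 1 n, (if j ≤ d then (1 : ℝ) else 0) = d := by
  rw [Finset.sum_boole]
  have : {j ∈ Finset.Icc 1 n | j ≤ d} = Finset.Icc 1 d := by
    ext j; simp only [Finset.mem_filter, Finset.mem_Icc]; omega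
  simp [this]

theorem exists_near_zero_of_no_crossing {X : Type*} [MetricSpace X] [CompactSpace X] [Nonempty X]
    {n : ℕ} {f : ℕ → X → ℝ}
    (hf : ∀ j ≤ n, Continuous (f j)) (h0 : ∀ x, f 0 x < 0) (hn : ∀ x, 0 < f n x)
    (hadj : ∀ j < n, ∀ x, 0 ≤ f j x * f (j + 1) x)
    (hcr : ∀ x i j, i < j → j ≤ n → 0 < f i x → 0 ≤ f j x) {ε : ℝ} (hε : 0 < ε) :
    ∃ h : X → ℝ, Continuous h ∧ ∀ x, ∃ i ≤ n, |h x - i| ≤ 1 ∧ |f i x| < ε := by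
  classical
  obtain ⟨m0, hm0, hm0'⟩ := exists_pos_lower_bound (hf 0 (Nat.zero_le n)).neg
    fun x => neg_pos.mpr (h0 x)
  obtain ⟨m1, hm1, hm1'⟩ := exists_pos_lower_bound (hf n le_rfl) hn
  obtain ⟨θ, hθ, hθm⟩ := exists_between (lt_min hε (lt_min hm0 hm1))
  obtain ⟨hθε, hθ0, hθn⟩ : θ < ε ∧ θ < m0 ∧ θ < m1 := by simpa using hθm
  let A : ℕ → Set X := fun j => ⋃ i ∈ Finset.Icc j n, {x | f i x ≤ -θ}
  let B : ℕ → Set X := fun j => ⋃ i ∈ (Finset.range (n + 1)).filter (· < j), {x | θ ≤ f i x}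
  have hA : ∀ j, IsClosed (A j) := fun j => isClosed_biUnion_finset fun i hi =>
    isClosed_le (hf i (Finset.mem_Icc.mp hi).2) continuous_const
  have hB : ∀ j, IsClosed (B j) := fun j => isClosed_biUnion_finset fun i hi =>
    isClosed_le continuous_const
      (hf i (Nat.lt_succ_iff.mp (Finset.mem_range.mp (Finset.mem_filter.mp hi).1)))
  have hAB : ∀ j, Disjoint (B j) (A j) := by
    intro j
    rw [Set.disjoint_left]
    intro x hx hx'
    simp only [A, B, mem_iUnion, Finset.mem_filter, Finset.mem_range, Finset.mem_Icc,
      exists_prop] at hx hx'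
    obtain ⟨i, hi, hxi⟩ := hx
    obtain ⟨k, hk, hxk⟩ := hx'
    have := hcr x i k (by omega) (by omega) (hθ.trans_le hxi)
    have : f k x ≤ -θ := hxk
    linarith
  choose φ hφB hφA hφ using fun j =>
    exists_continuous_zero_one_of_isClosed (hB j) (hA j) (hAB j)
  refine ⟨fun x => ∑ j ∈ Finset.Icc 1 n, φ j x,
    continuous_finsetSum _ fun j _ => (φ j).continuous, fun x => ?_⟩
  have hD : (Finset.filter (fun i => f i x ≤ -θ) (Finset.range (n + 1))).Nonempty :=
    ⟨0, by have : m0 < -f 0 x := hm0' x; simp; linarith⟩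
  have hP : (Finset.filter (fun i => θ ≤ f i x) (Finset.range (n + 1))).Nonempty :=
    ⟨n, by have := hm1' x; simp; linarith⟩
  obtain ⟨d, hd, hdmax⟩ := Finset.exists_max_image _ id hD
  obtain ⟨p, hp, hpmin⟩ := Finset.exists_min_image _ id hP
  simp only [Finset.mem_filter, Finset.mem_range, id] at hd hdmax hp hpmin
  have hdp : d < p := by
    by_contra! hc
    rcases hc.lt_or_eq with hc | hc
    · linarith [hcr x p d hc (by omega) (by linarith)]
    · rw [hc] at hp; linarith
  have hdp2 : d + 1 < p := by
    refine lt_of_le_of_ne hdp fun h => ?_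
    have := hadj d (by omega) x
    rw [h] at this
    nlinarith [mul_pos (show 0 < -f d x by linarith) (show 0 < f p x by linarith)]
  have hlow : (d : ℝ) ≤ ∑ j ∈ Finset.Icc 1 n, φ j x := by
    rw [← sum_Icc_boole_le (show d ≤ n by omega)]
    refine Finset.sum_le_sum fun j hj => ?_
    split_ifs with hjd
    · refine (hφA j ?_).ge
      simp only [A, mem_iUnion, Finset.mem_Icc]
      exact ⟨d, ⟨hjd, by omega⟩, hd.2⟩
    · exact (hφ j x).1
  have hup : ∑ j ∈ Finset.Icc 1 n, φ j x ≤ p := by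
    rw [← sum_Icc_boole_le (show p ≤ n by omega)]
    refine Finset.sum_le_sum fun j hj => ?_
    split_ifs with hjp
    · exact (hφ j x).2
    · refine (hφB j ?_).le
      simp only [B, mem_iUnion, Finset.mem_filter, Finset.mem_range]
      exact ⟨p, ⟨hp.1, by omega⟩, hp.2⟩
  have hmid : ∀ i, d < i → i < p → |f i x| < ε := by
    intro i h1 h2
    rw [abs_lt]
    constructor
    · by_contra! hc
      have := hdmax i ⟨by omega, by linarith⟩
      omega
    · by_contra! hc
      have := hpmin i ⟨by omega, by linarith⟩
      omega
  beta_reduce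
  generalize ∑ j ∈ Finset.Icc 1 n, φ j x = H at hlow hup ⊢
  have hdp2' : (d : ℝ) + 1 + 1 ≤ p := by exact_mod_cast hdp2
  rcases le_or_gt H (d + 1) with h | h
  · refine ⟨d + 1, by omega, ?_, hmid _ (by omega) (by omega)⟩
    push_cast
    rw [abs_le]; constructor <;> linarith
  rcases le_or_gt (p : ℝ) (H + 1) with h' | h'
  · refine ⟨p - 1, by omega, ?_, hmid _ (by omega) (by omega)⟩
    rw [Nat.cast_sub (by omega)]
    push_cast
    rw [abs_le]; constructor <;> linarith
  · have hH : 0 ≤ H := (Nat.cast_nonneg d).trans hlow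
    have e1 := Nat.floor_le hH
    have e2 := Nat.lt_floor_add_one H
    have e3 : d + 1 ≤ ⌊H⌋₊ := Nat.le_floor (by push_cast; exact h.le)
    have e4 : ⌊H⌋₊ < p := by
      have : (⌊H⌋₊ : ℝ) < p := by linarith
      exact_mod_cast this
    refine ⟨⌊H⌋₊, by omega, ?_, hmid _ (by omega) e4⟩
    rw [abs_le]; constructor <;> linarith

/-- On a hereditarily indecomposable continuum of span zero, one may continuously follow
approximate zeros of a finite sequence of functions which begins with a negative function, ends
with a positive one, and in which consecutive functions never have opposite signs. -/
theorem exists_near_zero {X : Type*} [MetricSpace X] [CompactSpace X] [Nonempty X]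
    (hX : HereditarilyIndecomposable X) (hs : SpanZero X) {n : ℕ} {f : ℕ → X → ℝ}
    (hf : ∀ j ≤ n, Continuous (f j)) (h0 : ∀ x, f 0 x < 0) (hn : ∀ x, 0 < f n x)
    (hadj : ∀ j < n, ∀ x, 0 ≤ f j x * f (j + 1) x) {ε : ℝ} (hε : 0 < ε) :
    ∃ h : X → ℝ, Continuous h ∧ ∀ x, ∃ i ≤ n, |h x - i| ≤ 1 ∧ |f i x| < ε := by
  have main : ∀ M : ℕ, ∀ f : ℕ → X → ℝ, (∀ j ≤ n, Continuous (f j)) → (∀ x, f 0 x < 0) →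
      (∀ x, 0 < f n x) → (∀ j < n, ∀ x, 0 ≤ f j x * f (j + 1) x) →
      (∀ x, signCount (f · x) n ≤ M + 2) → ∀ ε > 0,
      ∃ h : X → ℝ, Continuous h ∧ ∀ x, ∃ i ≤ n, |h x - i| ≤ 1 ∧ |f i x| < ε := by
    intro M
    induction M with
    | zero =>
      intro f hf h0 hn hadj hM ε hε
      refine exists_near_zero_of_no_crossing hf h0 hn hadj (fun x i j hij hj hi => ?_) hε
      by_contra! hc
      have e1 := signCount_lt (h0 x) hij.le (mul_neg_of_pos_of_neg hi hc) (s := (f · x))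
      obtain ⟨k, hk⟩ := signCount_even (h0 x) hi (s := (f · x))
      have e2 := one_le_signCount (f · x) i
      have e3 := monotone_signCount (f · x) hj
      have e4 := hM x
      omega
    | succ M ih =>
      intro f hf h0 hn hadj hM ε hε
      obtain ⟨f', hf', h0', hn', hadj', hle, hcount⟩ :=
        exists_fewer_sign_changes hX hs hf h0 hn hadj (half_pos hε)
      obtain ⟨h, hh, hh'⟩ := ih f' hf' h0' hn' hadj'
        (fun x => (hcount x).trans (by have := hM x; omega)) _ (half_pos hε)
      refine ⟨h, hh, fun x => ?_⟩
      obtain ⟨i, hi, h1, h2⟩ := hh' x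
      exact ⟨i, hi, h1, by linarith [hle i x]⟩
  exact main n f hf h0 hn hadj (fun x => (signCount_le _ n).trans (by omega)) ε hε

/-! ### Span zero and hereditary indecomposability imply arc-likeness -/

theorem SpanZero.exists_step {X : Type*} [MetricSpace X] [CompactSpace X] (hs : SpanZero X) {ε : ℝ}
    (hε : 0 < ε) : ∃ δ > 0, ∀ p ∈ farPairs X ε,
      ¬ ∀ y, ∃ w : X × X, dist w.2 y < δ ∧ Relation.ReflTransGen (StepIn (farPairs X ε) δ) p w := by
  by_contra! hcon
  choose! p hp w hw hch using fun k : ℕ => hcon (1 / ((k : ℝ) + 1)) (by positivity)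
  have hend : ∀ k y, w k y ∈ farPairs X ε := fun k y => by
    rcases Relation.ReflTransGen.cases_tail (hch k y) with h | ⟨b, -, h⟩
    · rw [h]; exact hp k
    · exact h.2.1
  obtain ⟨p', hp', φ, hφ, hlim⟩ := (isCompact_farPairs X ε).tendsto_subseq hp
  have hZsub := connectedComponentIn_subset (farPairs X ε) p'
  obtain ⟨hZ, hZ'⟩ := connectedComponentIn_farPairs_props hp'
  refine (hs.not_subset hε hZ hZ' hZsub).1 fun y _ => ?_
  obtain ⟨v, hv, ψ, hψ, hlim'⟩ := (isCompact_farPairs X ε).tendsto_subseq fun k => hend (φ k) y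
  have hone : Filter.Tendsto (fun k => 1 / (((φ (ψ k) : ℕ) : ℝ) + 1)) Filter.atTop (𝓝 0) :=
    tendsto_one_div_add_atTop_nhds_zero_nat.comp (hφ.comp hψ).tendsto_atTop
  refine ⟨v, mem_connectedComponentIn_of_chains (isCompact_farPairs X ε) hp' hv fun δ hδ => ?_, ?_⟩
  · obtain ⟨k, h1, h2, h3⟩ := ((Metric.tendsto_nhds.mp (hlim.comp hψ.tendsto_atTop) δ hδ).and
      ((Metric.tendsto_nhds.mp hlim' δ hδ).and (hone.eventually_lt_const hδ))).exists
    exact ⟨_, _, hp _, h1, h2,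
      Relation.ReflTransGen.mono (fun a b hab => hab.mono h3.le) _ _ (hch _ _)⟩
  · refine tendsto_nhds_unique ((continuous_snd.tendsto v).comp hlim') ?_
    rw [tendsto_iff_dist_tendsto_zero]
    exact squeeze_zero (fun _ => dist_nonneg) (fun k => (hw _ _).le) hone

/-- A move between states `(x, j)`, where the distance of `x` to `z j` is at least `ε`: either the
index is kept and the point moves by less than `δ`, or the point is kept and the index changes by
one. -/
def ChainMove {X : Type*} [MetricSpace X] (z : ℕ → X) (N : ℕ) (ε δ : ℝ) (a b : X × ℕ) : Prop :=
  (a.2 ≤ N ∧ b.2 ≤ N ∧ ε ≤ dist a.1 (z a.2) ∧ ε ≤ dist b.1 (z b.2)) ∧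
  ((a.2 = b.2 ∧ dist a.1 b.1 < δ) ∨ (a.1 = b.1 ∧ (b.2 = a.2 + 1 ∨ a.2 = b.2 + 1)))

section ChainMove

variable {X : Type*} [MetricSpace X] {z : ℕ → X} {N : ℕ} {ε δ : ℝ}

theorem ChainMove.symm {a b : X × ℕ} (h : ChainMove z N ε δ a b) : ChainMove z N ε δ b a := by
  obtain ⟨⟨h1, h2, h3, h4⟩, h5⟩ := h
  refine ⟨⟨h2, h1, h4, h3⟩, ?_⟩
  rcases h5 with ⟨h5, h6⟩ | ⟨h5, h6⟩
  · exact .inl ⟨h5.symm, by rwa [dist_comm]⟩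
  · exact .inr ⟨h5.symm, h6.symm⟩

theorem ChainMove.stepIn (hδ : 0 < δ) (hz : ∀ i < N, dist (z i) (z (i + 1)) < δ) {a b : X × ℕ}
    (h : ChainMove z N ε δ a b) : StepIn (farPairs X ε) δ (a.1, z a.2) (b.1, z b.2) := by
  obtain ⟨⟨h1, h2, h3, h4⟩, h5⟩ := h
  refine ⟨h3, h4, ?_⟩
  rw [Prod.dist_eq]
  rcases h5 with ⟨h5, h6⟩ | ⟨h5, h6 | h6⟩
  · simp only [h5, dist_self]
    exact max_lt h6 hδ
  · simp only [h5, h6, dist_self]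
    exact max_lt hδ (hz _ (by omega))
  · simp only [h5, h6, dist_self]
    rw [dist_comm]
    exact max_lt hδ (hz _ (by omega))

theorem ChainMove.exists_of_le {a b : X × ℕ} (ha : a.2 = 0)
    (h : Relation.ReflTransGen (ChainMove z N ε δ) a b) :
    ∀ j ≤ b.2, ∃ x, Relation.ReflTransGen (ChainMove z N ε δ) a (x, j) := by
  induction h with
  | refl =>
    intro j hj
    obtain rfl : j = a.2 := by omega
    exact ⟨a.1, .refl⟩
  | @tail b c hab hbc ih =>
    intro j hj
    by_cases hjb : j ≤ b.2
    · exact ih j hjb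
    · have : j = c.2 := by
        rcases hbc.2 with ⟨h, -⟩ | ⟨-, h⟩ <;> omega
      exact ⟨c.1, this ▸ hab.tail hbc⟩

theorem SpanZero.exists_chainMove_step [CompactSpace X] (hs : SpanZero X) (hε : 0 < ε) :
    ∃ δ' > 0, ∀ δ > 0, δ ≤ δ' → ∀ (N : ℕ) (z : ℕ → X), (∀ i < N, dist (z i) (z (i + 1)) < δ) →
      (∀ y, ∃ i ≤ N, dist (z i) y < δ) → ∀ x x', ε ≤ dist x (z 0) →
      ¬ Relation.ReflTransGen (ChainMove z N ε δ) (x, 0) (x', N) := by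
  obtain ⟨δ', hδ', h⟩ := hs.exists_step hε
  refine ⟨δ', hδ', fun δ hδ hle N z hz hdense x x' hx hch => h (x, z 0) hx fun y => ?_⟩
  obtain ⟨i, hi, hiy⟩ := hdense y
  obtain ⟨a, ha⟩ := ChainMove.exists_of_le rfl hch i hi
  refine ⟨(a, z i), hiy.trans_le hle, ?_⟩
  exact Relation.ReflTransGen.lift (fun u : X × ℕ => (u.1, z u.2))
    (fun u v huv => (huv.stepIn hδ hz).mono hle) _ _ ha

end ChainMove

theorem reflTransGen_dist_lt {X : Type*} [MetricSpace X] [ConnectedSpace X] {δ : ℝ} (hδ : 0 < δ)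
    (x y : X) : Relation.ReflTransGen (fun a b : X => dist a b < δ) x y := by
  have : IsClopen {y | Relation.ReflTransGen (fun a b : X => dist a b < δ) x y} := by
    constructor
    · rw [← isOpen_compl_iff, Metric.isOpen_iff]
      exact fun y hy => ⟨δ, hδ, fun w hw hw' => hy (Relation.ReflTransGen.tail hw' hw)⟩
    · rw [Metric.isOpen_iff]
      refine fun y hy => ⟨δ, hδ, fun w hw => Relation.ReflTransGen.tail hy ?_⟩
      rwa [dist_comm]
  have h := this.eq_univ ⟨x, .refl⟩
  exact h.ge (mem_univ y)

theorem exists_dense_chain (X : Type*) [MetricSpace X] [CompactSpace X] [ConnectedSpace X] {δ : ℝ}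
    (hδ : 0 < δ) : ∃ (N : ℕ) (z : ℕ → X), (∀ i < N, dist (z i) (z (i + 1)) < δ) ∧
      ∀ y, ∃ i ≤ N, dist (z i) y < δ := by
  classical
  have main : ∀ S : Finset X, ∃ (N : ℕ) (z : ℕ → X), (∀ i < N, dist (z i) (z (i + 1)) < δ) ∧
      ∀ y ∈ S, ∃ i ≤ N, z i = y := by
    intro S
    induction S using Finset.induction_on with
    | empty => exact ⟨0, fun _ => Classical.arbitrary X, by simp, by simp⟩
    | insert s S _ ih =>
      obtain ⟨N, z, hz, hS⟩ := ih
      obtain ⟨m, g, g0, gm, hg⟩ := exists_path_of_reflTransGen (reflTransGen_dist_lt hδ (z N) s)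
      refine ⟨N + m, fun i => if i ≤ N then z i else g (i - N), fun i hi => ?_, fun y hy => ?_⟩
      · rcases lt_trichotomy i N with h | rfl | h
        · simpa [h.le, Nat.succ_le_of_lt h] using hz i h
        · simpa [g0] using hg 0 (by omega)
        · have e : i + 1 - N = i - N + 1 := by omega
          simpa [h.not_ge, h.not_gt, e] using hg (i - N) (by omega)
      · rcases Finset.mem_insert.mp hy with rfl | hy
        · refine ⟨N + m, le_rfl, ?_⟩
          by_cases hm : m = 0
          · subst hm; simp [← gm, g0]
          · simp [hm, gm]
        · obtain ⟨i, hi, rfl⟩ := hS y hy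
          exact ⟨i, by omega, by simp [hi]⟩
  obtain ⟨t, -, ht, hcov⟩ := finite_cover_balls_of_compact (isCompact_univ (X := X)) hδ
  obtain ⟨N, z, hz, hS⟩ := main ht.toFinset
  refine ⟨N, z, hz, fun y => ?_⟩
  obtain ⟨x, hx, hxy⟩ := mem_iUnion₂.mp (hcov (mem_univ y))
  obtain ⟨i, hi, rfl⟩ := hS x (ht.mem_toFinset.mpr hx)
  exact ⟨i, hi, by rw [dist_comm]; exact hxy⟩

theorem exists_rescale {X : Type*} [TopologicalSpace X] [CompactSpace X] [ConnectedSpace X]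
    {h : X → ℝ} (hh : Continuous h) {x₁ x₂ : X} (hne : h x₁ ≠ h x₂) :
    ∃ g : X → unitInterval, Continuous g ∧ Function.Surjective g ∧
      ∀ x y, g x = g y → h x = h y := by
  obtain ⟨a, -, ha⟩ := isCompact_univ.exists_isMinOn univ_nonempty hh.continuousOn
  obtain ⟨b, -, hb⟩ := isCompact_univ.exists_isMaxOn univ_nonempty hh.continuousOn
  have ha : ∀ x, h a ≤ h x := fun x => ha (mem_univ x)
  have hb : ∀ x, h x ≤ h b := fun x => hb (mem_univ x)
  have hab : 0 < h b - h a := by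
    refine sub_pos.mpr (lt_of_le_of_ne (ha b) fun he => hne ?_)
    linarith [ha x₁, hb x₁, ha x₂, hb x₂]
  refine ⟨fun x => ⟨(h x - h a) / (h b - h a), div_nonneg (sub_nonneg.mpr (ha x)) hab.le,
    (div_le_one hab).mpr (by linarith [hb x])⟩, ?_, ?_, ?_⟩
  · exact Continuous.subtype_mk ((hh.sub continuous_const).div_const _) _
  · rintro ⟨t, ht0, ht1⟩
    obtain ⟨x, hx⟩ := intermediate_value_univ a b hh
      (show h a + t * (h b - h a) ∈ Icc (h a) (h b) from ⟨by nlinarith, by nlinarith⟩)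
    refine ⟨x, Subtype.ext ?_⟩
    simp only [hx]
    field_simp
    ring
  · intro x y hxy
    have := congrArg Subtype.val hxy
    simp only at this
    rw [div_left_inj' hab.ne'] at this
    linarith

section exists_chain_map

variable {X : Type*} [MetricSpace X]

open Classical in
/-- The functions measuring the distance to the links of a chain, signed according to whether the
bottom of the chain can be reached. -/
noncomputable def chainDist (z : ℕ → X) (N : ℕ) (ε δ : ℝ) (j : ℕ) (x : X) : ℝ :=
  (if ∃ y, ε ≤ dist y (z 0) ∧ Relation.ReflTransGen (ChainMove z N ε δ) (y, 0) (x, j) then -1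
    else 1) * max (dist x (z j) - ε) 0

theorem ChainMove.chainDist_mul_nonneg {z : ℕ → X} {N : ℕ} {ε δ : ℝ} {a b : X × ℕ}
    (h : ChainMove z N ε δ a b) :
    0 ≤ chainDist z N ε δ a.2 a.1 * chainDist z N ε δ b.2 b.1 := by
  have : (∃ y, ε ≤ dist y (z 0) ∧ Relation.ReflTransGen (ChainMove z N ε δ) (y, 0) (a.1, a.2)) ↔
      ∃ y, ε ≤ dist y (z 0) ∧ Relation.ReflTransGen (ChainMove z N ε δ) (y, 0) (b.1, b.2) :=
    exists_congr fun y => and_congr_right fun _ => ⟨fun h' => h'.tail h, fun h' => h'.tail h.symm⟩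
  have h1 : 0 ≤ max (dist a.1 (z a.2) - ε) 0 := le_max_right _ _
  have h2 : 0 ≤ max (dist b.1 (z b.2) - ε) 0 := le_max_right _ _
  classical
  rw [chainDist, chainDist, if_congr this rfl rfl]
  split_ifs <;> nlinarith [mul_nonneg h1 h2]

theorem abs_chainDist (z : ℕ → X) (N : ℕ) (ε δ : ℝ) (j : ℕ) (x : X) :
    |chainDist z N ε δ j x| = max (dist x (z j) - ε) 0 := by
  rw [chainDist, abs_mul, abs_of_nonneg (le_max_right (dist x (z j) - ε) 0)]
  split_ifs <;> simp

theorem continuous_chainDist (z : ℕ → X) {N : ℕ} (ε : ℝ) {δ : ℝ} (hδ : 0 < δ) {j : ℕ}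
    (hj : j ≤ N) : Continuous (chainDist z N ε δ j) := by
  classical
  refine continuous_sign_mul (((continuous_id.dist continuous_const).sub continuous_const).max
    continuous_const) (fun x => by split_ifs <;> simp) hδ fun x y hxy h1 h2 => ?_
  have aux : ∀ w : X, max (dist w (z j) - ε) 0 ≠ 0 → ε ≤ dist w (z j) := by
    intro w hw
    by_contra! hc
    exact hw (max_eq_right (by linarith))
  have h : ChainMove z N ε δ (x, j) (y, j) := ⟨⟨hj, hj, aux x h1, aux y h2⟩, .inl ⟨rfl, hxy⟩⟩
  exact if_congr (exists_congr fun y => and_congr_right fun _ =>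
    ⟨fun h' => h'.tail h, fun h' => h'.tail h.symm⟩) rfl rfl

/-- On a hereditarily indecomposable continuum of span zero there are maps to the line with
arbitrarily small fibers. -/
theorem exists_map_dist_lt [CompactSpace X] [ConnectedSpace X] (hX : HereditarilyIndecomposable X)
    (hs : SpanZero X) {ε : ℝ} (hε : 0 < ε) :
    ∃ h : X → ℝ, Continuous h ∧ ∀ x y, h x = h y → dist x y < ε := by
  obtain ⟨η, hη, hηε⟩ := exists_between (show 0 < min (ε / 8) 1 by positivity)
  obtain ⟨hηε, hη1⟩ := lt_min_iff.mp hηε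
  obtain ⟨δ', hδ', hstep⟩ := hs.exists_chainMove_step hη
  have hδ : 0 < min δ' η := lt_min hδ' hη
  obtain ⟨N, z, hz, hdense⟩ := exists_dense_chain X hδ
  have hstep := hstep _ hδ (min_le_left _ _) N z hz hdense
  have hδη : min δ' η ≤ η := min_le_right _ _
  generalize min δ' η = δ at *
  let F : ℕ → X → ℝ := fun j => match j with
    | 0 => fun _ => -1
    | j + 1 => if j = N + 1 then fun _ => 1 else chainDist z N η δ j
  have F0 : ∀ x, F 0 x = -1 := fun x => rfl
  have F1 : ∀ x, F (N + 2) x = 1 := fun x => by simp [F]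
  have F2 : ∀ j ≤ N, F (j + 1) = chainDist z N η δ j := fun j hj => by
    simp only [F, if_neg (show j ≠ N + 1 by omega)]
  have hlow : ∀ x, chainDist z N η δ 0 x ≤ 0 := by
    intro x
    rw [chainDist]
    rcases le_or_gt η (dist x (z 0)) with h | h
    · rw [if_pos ⟨x, h, .refl⟩]
      linarith [le_max_right (dist x (z 0) - η) 0]
    · rw [max_eq_right (by linarith), mul_zero]
  have hup : ∀ x, 0 ≤ chainDist z N η δ N x := by
    intro x
    rw [chainDist, if_neg, one_mul]
    · exact le_max_right _ _
    · rintro ⟨y, hy, hyx⟩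
      exact hstep y x hy hyx
  have hF : ∀ j ≤ N + 2, Continuous (F j) := by
    intro j hj
    obtain rfl | ⟨j, rfl⟩ : j = 0 ∨ ∃ i, j = i + 1 := by cases j <;> simp
    · exact continuous_const
    · rcases eq_or_ne j (N + 1) with rfl | hj'
      · rw [show F (N + 1 + 1) = fun _ => 1 from funext F1]
        exact continuous_const
      · rw [F2 j (by omega)]
        exact continuous_chainDist z η hδ (by omega)
  have hadj : ∀ j < N + 2, ∀ x, 0 ≤ F j x * F (j + 1) x := by
    intro j hj x
    obtain rfl | ⟨j, rfl⟩ : j = 0 ∨ ∃ i, j = i + 1 := by cases j <;> simp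
    · rw [F0 x, F2 0 (Nat.zero_le _)]
      linarith [hlow x]
    · rcases eq_or_ne j N with rfl | hj'
      · rw [F1 x, F2 j le_rfl, mul_one]
        exact hup x
      · rw [F2 j (by omega), F2 (j + 1) (by omega)]
        by_cases h1 : η ≤ dist x (z j)
        · by_cases h2 : η ≤ dist x (z (j + 1))
          · exact ChainMove.chainDist_mul_nonneg (a := (x, j)) (b := (x, j + 1))
              ⟨⟨by simp only; omega, by simp only; omega, h1, h2⟩, .inr ⟨rfl, .inl rfl⟩⟩
          · rw [abs_eq_zero.mp ((abs_chainDist z N η δ (j + 1) x).trans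
              (max_eq_right (by linarith))), mul_zero]
        · rw [abs_eq_zero.mp ((abs_chainDist z N η δ j x).trans
              (max_eq_right (by linarith))), zero_mul]
  obtain ⟨h, hh, hnear⟩ := exists_near_zero hX hs (n := N + 2) (f := F) hF
    (fun x => by rw [F0 x]; norm_num) (fun x => by rw [F1 x]; norm_num) hadj hη
  have key : ∀ x, ∃ j ≤ N, |h x - (j + 1)| ≤ 1 ∧ dist x (z j) < 2 * η := by
    intro x
    obtain ⟨i, hi, h1, h2⟩ := hnear x
    obtain rfl | ⟨j, rfl⟩ : i = 0 ∨ ∃ j, i = j + 1 := by cases i <;> simp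
    · rw [F0 x] at h2; norm_num at h2; linarith
    · rcases eq_or_ne j (N + 1) with rfl | hj
      · rw [F1 x] at h2; norm_num at h2; linarith
      · refine ⟨j, by omega, by exact_mod_cast h1, ?_⟩
        rw [F2 j (by omega), abs_chainDist] at h2
        linarith [le_max_left (dist x (z j) - η) 0]
  refine ⟨h, hh, fun x y hxy => ?_⟩
  obtain ⟨i, hi, hix, hix'⟩ := key x
  obtain ⟨j, hj, hjy, hjy'⟩ := key y
  rw [hxy] at hix
  have hzz : ∀ i j, i ≤ j → j ≤ N → j ≤ i + 2 → dist (z i) (z j) ≤ 2 * δ := by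
    intro i j h1 h2 h3
    obtain rfl | rfl | rfl : j = i ∨ j = i + 1 ∨ j = i + 2 := by omega
    · simp; linarith
    · linarith [hz i (by omega)]
    · linarith [hz i (by omega), hz (i + 1) (by omega),
        dist_triangle (z i) (z (i + 1)) (z (i + 2))]
  have hij : dist (z i) (z j) ≤ 2 * δ := by
    have e := abs_le.mp hix
    have e' := abs_le.mp hjy
    rcases le_total i j with hle | hle
    · have : (j : ℝ) ≤ i + 2 := by linarith
      exact hzz i j hle hj (by exact_mod_cast this)
    · have : (i : ℝ) ≤ j + 2 := by linarith
      rw [dist_comm]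
      exact hzz j i hle hi (by exact_mod_cast this)
  have t1 := dist_triangle x (z i) y
  have t2 := dist_triangle (z i) (z j) y
  rw [dist_comm] at hjy'
  linarith

end exists_chain_map

theorem arcLike_of_spanZero {X : Type*} [MetricSpace X] [CompactSpace X] [ConnectedSpace X]
    [Nontrivial X] (hX : HereditarilyIndecomposable X) (hs : SpanZero X) : ArcLike X := by
  intro ε hε
  obtain ⟨x₁, x₂, hne⟩ := exists_pair_ne X
  obtain ⟨h, hh, hfib⟩ := exists_map_dist_lt hX hs
    (show 0 < min (ε / 2) (dist x₁ x₂) from lt_min (half_pos hε) (dist_pos.mpr hne))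
  obtain ⟨g, hg, hsurj, hgh⟩ := exists_rescale hh (x₁ := x₁) (x₂ := x₂)
    fun h => ((hfib _ _ h).trans_le (min_le_right _ _)).false
  refine ⟨g, hg, hsurj, fun y => ?_⟩
  have : Metric.diam (g ⁻¹' {y}) ≤ ε / 2 := by
    refine Metric.diam_le_of_forall_dist_le (half_pos hε).le fun a ha b hb => ?_
    exact ((hfib a b (hgh a b (ha.trans hb.symm))).trans_le (min_le_left _ _)).le
  linarith

/-! ### Homeomorphism invariance, and arc-like continua have span zero -/

theorem HereditarilyIndecomposable.of_homeomorph {X Y : Type*} [TopologicalSpace X]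
    [TopologicalSpace Y] (e : X ≃ₜ Y) (hY : HereditarilyIndecomposable Y) :
    HereditarilyIndecomposable X := by
  rintro K hK hK' hK'' ⟨A, B, hA, hA', hB, hB', rfl, hne, hne'⟩
  refine hY (e '' (A ∪ B)) (hK.image e.continuous) (hK'.image e e.continuous.continuousOn)
    (hK''.image e.injective) ⟨e '' A, e '' B, hA.image e.continuous,
    hA'.image e e.continuous.continuousOn, hB.image e.continuous,
    hB'.image e e.continuous.continuousOn, (image_union _ _ _).symm, ?_, ?_⟩
  · exact fun h => hne (e.injective.image_injective h)
  · exact fun h => hne' (e.injective.image_injective h)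

theorem SpanZero.of_homeomorph {X Y : Type*} [TopologicalSpace X] [TopologicalSpace Y]
    (e : X ≃ₜ Y) (hY : SpanZero Y) : SpanZero X := by
  intro Z hZ hZ' hsub
  have hc : Continuous (Prod.map e e) := e.continuous.prodMap e.continuous
  have hsub' : Prod.fst '' (Prod.map e e '' Z) ⊆ Prod.snd '' (Prod.map e e '' Z) := by
    rintro _ ⟨_, ⟨z, hz, rfl⟩, rfl⟩
    obtain ⟨w, hw, hwz⟩ := hsub ⟨z, hz, rfl⟩
    exact ⟨_, ⟨w, hw, rfl⟩, congrArg e hwz⟩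
  obtain ⟨y, ⟨a, b⟩, hab, h⟩ := hY (Prod.map e e '' Z) (hZ.image hc)
    (hZ'.image _ hc.continuousOn) hsub'
  obtain ⟨h1, h2⟩ := Prod.ext_iff.mp h
  obtain rfl : a = b := e.injective (h1.trans h2.symm)
  exact ⟨a, hab⟩

theorem ArcLike.exists_map_dist_lt {X : Type*} [MetricSpace X] [CompactSpace X] (h : ArcLike X)
    {ε : ℝ} (hε : 0 < ε) : ∃ f : X → ℝ, Continuous f ∧ (range f = Icc 0 1) ∧
      ∀ x y, f x = f y → dist x y < ε := by
  obtain ⟨f, hf, hs, hd⟩ := h ε hε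
  refine ⟨fun x => f x, continuous_subtype_val.comp hf, ?_, fun x y hxy => ?_⟩
  · ext t
    constructor
    · rintro ⟨x, rfl⟩
      exact (f x).2
    · intro ht
      obtain ⟨x, hx⟩ := hs ⟨t, ht⟩
      exact ⟨x, by simp [hx]⟩
  · have hy : y ∈ f ⁻¹' {f x} := Subtype.ext hxy.symm
    exact (Metric.dist_le_diam_of_mem Metric.isBounded_of_compactSpace
      (show x ∈ f ⁻¹' {f x} from rfl) hy).trans_lt (hd (f x))

theorem ArcLike.spanZero {X : Type*} [MetricSpace X] [CompactSpace X] (h : ArcLike X) :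
    SpanZero X := by
  intro Z hZ hZ' hsub
  by_contra! hcon
  obtain ⟨w, hw, hmin⟩ := hZ.exists_isMinOn hZ'.nonempty
    (continuous_fst.dist continuous_snd).continuousOn
  have hpos : 0 < dist w.1 w.2 := dist_pos.mpr fun he => hcon w.1 (by
    have : w = (w.1, w.1) := Prod.ext rfl he.symm
    rwa [← this])
  obtain ⟨f, hf, -, hfib⟩ := h.exists_map_dist_lt hpos
  have hf2 : Continuous fun z : X × X => f z.2 := hf.comp continuous_snd
  obtain ⟨a, ha, hamin⟩ := hZ.exists_isMinOn hZ'.nonempty hf2.continuousOn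
  obtain ⟨b, hb, hbmax⟩ := hZ.exists_isMaxOn hZ'.nonempty hf2.continuousOn
  obtain ⟨a', ha', haa⟩ := hsub ⟨a, ha, rfl⟩
  obtain ⟨b', hb', hbb⟩ := hsub ⟨b, hb, rfl⟩
  have h1 : f a.2 ≤ f a.1 := by rw [← haa]; exact hamin ha'
  have h2 : f b.1 ≤ f b.2 := by rw [← hbb]; exact hbmax hb'
  obtain ⟨z, hz, hz0⟩ := hZ'.isPreconnected.intermediate_value hb ha
    (f := fun z => f z.1 - f z.2) ((hf.comp continuous_fst).sub hf2).continuousOn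
    (show (0 : ℝ) ∈ Icc _ _ from ⟨by simpa using h2, by simpa using h1⟩)
  exact (hfib z.1 z.2 (sub_eq_zero.mp hz0)).not_ge (hmin hz)

/-! ### Lifting a walk -/

theorem exists_lift_walk {X : Type*} [MetricSpace X] [CompactSpace X] [Nonempty X]
    (hX : HereditarilyIndecomposable X) (hs : SpanZero X) {f : X → ℝ} (hf : Continuous f) {T : ℕ}
    {u : ℕ → ℝ} {c : ℝ} (hc : 0 < c) (hc1 : c ≤ 1) (h0 : ∀ x, u 0 ≤ f x + c)
    (hT : ∀ x, f x - c ≤ u T) (hu : ∀ i < T, |u i - u (i + 1)| ≤ c) :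
    ∃ h : X → ℝ, Continuous h ∧ ∀ x, ∃ i ≤ T, |h x - i| ≤ 1 ∧ |u i - f x| < 2 * c := by
  let F : ℕ → X → ℝ := fun j => match j with
    | 0 => fun _ => -1
    | j + 1 => if j = T + 1 then fun _ => 1 else fun x => softThreshold c (u j - f x)
  have F0 : ∀ x, F 0 x = -1 := fun x => rfl
  have F1 : ∀ x, F (T + 2) x = 1 := fun x => by simp [F]
  have F2 : ∀ j ≤ T, F (j + 1) = fun x => softThreshold c (u j - f x) := fun j hj => by
    simp only [F, if_neg (show j ≠ T + 1 by omega)]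
  have hsoft : ∀ t, -c ≤ t → 0 ≤ softThreshold c t := fun t ht => by
    rcases le_or_gt c t with h | h
    · rw [softThreshold_of_pos hc.le h]; linarith
    · rw [softThreshold_of_le (abs_le.mpr ⟨ht, h.le⟩)]
  have hsoft' : ∀ t, t ≤ c → softThreshold c t ≤ 0 := fun t ht => by
    rcases le_or_gt t (-c) with h | h
    · rw [softThreshold_of_neg hc.le h]; linarith
    · rw [softThreshold_of_le (abs_le.mpr ⟨h.le, ht⟩)]
  have hF : ∀ j ≤ T + 2, Continuous (F j) := by
    intro j hj
    obtain rfl | ⟨j, rfl⟩ : j = 0 ∨ ∃ i, j = i + 1 := by cases j <;> simp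
    · exact continuous_const
    · rcases eq_or_ne j (T + 1) with rfl | hj'
      · rw [show F (T + 1 + 1) = fun _ => 1 from funext F1]
        exact continuous_const
      · rw [F2 j (by omega)]
        exact (continuous_softThreshold c).comp (continuous_const.sub hf)
  have hadj : ∀ j < T + 2, ∀ x, 0 ≤ F j x * F (j + 1) x := by
    intro j hj x
    obtain rfl | ⟨j, rfl⟩ : j = 0 ∨ ∃ i, j = i + 1 := by cases j <;> simp
    · rw [F0 x, F2 0 (Nat.zero_le _)]
      have := hsoft' (u 0 - f x) (by linarith [h0 x])
      simp only
      linarith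
    · rcases eq_or_ne j T with rfl | hj'
      · rw [F1 x, F2 j le_rfl, mul_one]
        exact hsoft _ (by linarith [hT x])
      · rw [F2 j (by omega), F2 (j + 1) (by omega)]
        have := abs_le.mp (hu j (by omega))
        rcases le_total 0 (u j - f x) with h | h
        · exact mul_nonneg (hsoft _ (by linarith)) (hsoft _ (by linarith))
        · exact mul_nonneg_of_nonpos_of_nonpos (hsoft' _ (by linarith)) (hsoft' _ (by linarith))
  obtain ⟨h, hh, hnear⟩ := exists_near_zero hX hs hF (fun x => by rw [F0 x]; norm_num)
    (fun x => by rw [F1 x]; norm_num) hadj hc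
  refine ⟨fun x => h x - 1, hh.sub continuous_const, fun x => ?_⟩
  obtain ⟨i, hi, h1, h2⟩ := hnear x
  obtain rfl | ⟨j, rfl⟩ : i = 0 ∨ ∃ j, i = j + 1 := by cases i <;> simp
  · rw [F0 x] at h2; norm_num at h2; linarith
  · rcases eq_or_ne j (T + 1) with rfl | hj
    · rw [F1 x] at h2; norm_num at h2; linarith
    · refine ⟨j, by omega, ?_, ?_⟩
      · rw [show h x - 1 - (j : ℝ) = h x - ((j + 1 : ℕ) : ℝ) by push_cast; ring]
        exact h1
      · rw [F2 j (by omega)] at h2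
        linarith [abs_le_abs_softThreshold_add hc.le (t := u j - f x)]

/-! ### Refining a pair of maps to the interval -/

theorem exists_interval_walk {m a b : ℝ} (ha : a ∈ Icc 0 m) (hb : b ∈ Icc 0 m) :
    ∃ S ≥ (0 : ℝ), ∃ w : ℝ → ℝ, (∀ s t, |w s - w t| ≤ |s - t|) ∧ (∀ s, w s ∈ Icc 0 m) ∧
      (∀ s ≤ 0, w s = a) ∧ (∀ s ≥ S, w s = b) ∧ (∃ s ∈ Icc 0 S, w s = 0) ∧
      ∃ s ∈ Icc 0 S, w s = m := by
  obtain ⟨ha0, ham⟩ := ha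
  obtain ⟨hb0, hbm⟩ := hb
  have hS : 0 ≤ a + 2 * m - b := by linarith
  have habs : ∀ x y d : ℝ, |(d - |x|) - (d - |y|)| ≤ |x - y| := fun x y d => by
    rw [sub_sub_sub_cancel_left, abs_sub_comm x]
    exact abs_abs_sub_abs_le y x
  have hlip : ∀ s t : ℝ, abs ((m - abs (m - |max 0 (min s (a + 2 * m - b)) - a|)) -
      (m - abs (m - |max 0 (min t (a + 2 * m - b)) - a|))) ≤ |s - t| := by
    intro s t
    refine (habs _ _ m).trans ((habs _ _ m).trans ?_)
    rw [sub_sub_sub_cancel_right]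
    calc _ ≤ |min s (a + 2 * m - b) - min t (a + 2 * m - b)| := by
          simpa using abs_max_sub_max_le_max 0 (min s (a + 2 * m - b)) 0 (min t (a + 2 * m - b))
      _ ≤ |s - t| := by simpa using abs_min_sub_min_le_max s (a + 2 * m - b) t (a + 2 * m - b)
  refine ⟨a + 2 * m - b, hS, fun s => m - abs (m - |max 0 (min s (a + 2 * m - b)) - a|), hlip, ?_, ?_,
    ?_, ⟨a, ⟨ha0, by linarith⟩, ?_⟩, ⟨a + m, ⟨by linarith, by linarith⟩, ?_⟩⟩
  · intro s
    have h1 : 0 ≤ max 0 (min s (a + 2 * m - b)) := le_max_left _ _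
    have h2 : max 0 (min s (a + 2 * m - b)) ≤ a + 2 * m - b := max_le hS (min_le_right _ _)
    beta_reduce
    generalize max 0 (min s (a + 2 * m - b)) = σ at h1 h2
    have h3 : |σ - a| ≤ 2 * m := abs_le.mpr ⟨by linarith, by linarith⟩
    have h4 : abs (m - |σ - a|) ≤ m := abs_le.mpr ⟨by linarith, by linarith [abs_nonneg (σ - a)]⟩
    exact ⟨by linarith, by linarith [abs_nonneg (m - |σ - a|)]⟩
  · intro s hs
    simp only
    rw [max_eq_left ((min_le_left _ _).trans hs), zero_sub, abs_neg, abs_of_nonneg ha0,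
      abs_of_nonneg (by linarith)]
    ring
  · intro s hs
    simp only
    rw [min_eq_right hs, max_eq_right hS, abs_of_nonneg (a := a + 2 * m - b - a) (by linarith),
      abs_of_nonpos (by linarith)]
    ring
  · simp only
    rw [min_eq_left (by linarith), max_eq_right ha0, sub_self, abs_zero, sub_zero,
      abs_of_nonneg (by linarith), sub_self]
  · simp only
    rw [min_eq_left (by linarith), max_eq_right (by linarith), add_sub_cancel_left,
      abs_of_nonneg (a := m) (by linarith), sub_self, abs_zero, sub_zero]

theorem exists_dist_lt_of_fibers {P : Type*} [MetricSpace P] [CompactSpace P] {p : P → ℝ}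
    (hp : Continuous p) {ε : ℝ} (hfib : ∀ y y', p y = p y' → dist y y' < ε) :
    ∃ ρ > 0, ∀ y y', |p y - p y'| < ρ → dist y y' < ε := by
  have hK : IsCompact {z : P × P | ε ≤ dist z.1 z.2} :=
    (isClosed_le continuous_const (continuous_fst.dist continuous_snd)).isCompact
  rcases eq_empty_or_nonempty {z : P × P | ε ≤ dist z.1 z.2} with h | h
  · refine ⟨1, one_pos, fun y y' _ => ?_⟩
    by_contra! hc
    exact (h ▸ (show (y, y') ∈ {z : P × P | ε ≤ dist z.1 z.2} from hc) : (y, y') ∈ (∅ : Set _))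
  · obtain ⟨w, hw, hmin⟩ := hK.exists_isMinOn h (f := fun z => |p z.1 - p z.2|)
      ((hp.comp continuous_fst).sub (hp.comp continuous_snd)).abs.continuousOn
    refine ⟨|p w.1 - p w.2|, ?_, fun y y' hy => ?_⟩
    · refine abs_pos.mpr (sub_ne_zero.mpr fun he => (hfib _ _ he).not_ge hw)
    · by_contra! hc
      exact hy.not_ge (hmin (show (y, y') ∈ {z : P × P | ε ≤ dist z.1 z.2} from hc))

theorem exists_refinement {X P : Type*} [MetricSpace X] [CompactSpace X] [ConnectedSpace X]
    [MetricSpace P] [CompactSpace P] (hX : HereditarilyIndecomposable X) (hs : SpanZero X)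
    (hP : ArcLike P) {f : X → ℝ} {p : P → ℝ} (hf : Continuous f) (hp : Continuous p)
    (hf' : range f = Icc 0 1) (hp' : range p = Icc 0 1) {r ε : ℝ} (hr : 0 < r) (hε : 0 < ε) :
    ∃ (g : X → ℝ) (q : P → ℝ) (s : ℝ), Continuous g ∧ Continuous q ∧ range g = Icc 0 1 ∧
      range q = Icc 0 1 ∧ 0 < s ∧ (∀ x y, |g x - q y| ≤ s → |f x - p y| ≤ r) ∧
      ∀ y y', |q y - q y'| ≤ 2 * s → dist y y' < ε := by
  obtain ⟨c, hc, hc'⟩ : ∃ c > 0, c ≤ min (r / 5) (1 / 8) := ⟨_, by positivity, le_rfl⟩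
  obtain ⟨hcr, hc8⟩ := le_min_iff.mp hc'
  obtain ⟨ε₁, hε₁, huc⟩ :=
    Metric.uniformContinuous_iff.mp (CompactSpace.uniformContinuous_of_continuous hp) c hc
  obtain ⟨q, hq, hq', hfib⟩ := hP.exists_map_dist_lt (lt_min hε₁ hε)
  obtain ⟨ρ, hρ, hρq⟩ := exists_dist_lt_of_fibers hq hfib
  have hpq : ∀ y y', |q y - q y'| < ρ → |p y - p y'| < c := fun y y' h =>
    huc ((hρq y y' h).trans_le (min_le_left _ _))
  obtain ⟨m, hm, hmρ⟩ : ∃ m > 0, 1 / m = ρ / 4 := ⟨4 / ρ, by positivity, by field_simp⟩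
  have hf01 : ∀ x, f x ∈ Icc 0 1 := fun x => hf' ▸ mem_range_self x
  have hp01 : ∀ y, p y ∈ Icc 0 1 := fun x => hp' ▸ mem_range_self x
  have hq01 : ∀ y, q y ∈ Icc 0 1 := fun x => hq' ▸ mem_range_self x
  have hY : ∀ t ∈ Icc 0 m, ∃ y, q y = t / m := fun t ht => by
    have : t / m ∈ range q := hq' ▸ ⟨div_nonneg ht.1 hm.le, (div_le_one hm).mpr ht.2⟩
    exact this
  obtain ⟨y₀, hy₀⟩ : (0 : ℝ) ∈ range p := hp' ▸ ⟨le_rfl, zero_le_one⟩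
  have : Nonempty P := ⟨y₀⟩
  choose! Y hY using hY
  obtain ⟨y₁, hy₁⟩ : (1 : ℝ) ∈ range p := hp' ▸ ⟨zero_le_one, le_rfl⟩
  have hmul : ∀ y, m * q y ∈ Icc 0 m := fun y =>
    ⟨mul_nonneg hm.le (hq01 y).1, mul_le_of_le_one_right hm.le (hq01 y).2⟩
  have hYq : ∀ y, |p (Y (m * q y)) - p y| < c := fun y => by
    refine hpq _ _ ?_
    rw [hY _ (hmul y), mul_div_cancel_left₀ _ hm.ne', sub_self, abs_zero]
    exact hρ
  obtain ⟨S, hS, w, hwlip, hw, hwa, hwb, ⟨s₀, hs₀, hws₀⟩, s₁, hs₁, hws₁⟩ :=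
    exists_interval_walk (hmul y₀) (hmul y₁)
  have hwcont : Continuous w := (LipschitzWith.of_dist_le_mul (K := 1) fun s t => by
    simpa [Real.dist_eq] using hwlip s t).continuous
  have hstep : ∀ s t y, |s - t| ≤ 1 → |w s / m - q y| ≤ ρ / 4 → |p (Y (w t)) - p y| < c := by
    intro s t y hst hsy
    refine hpq _ _ ?_
    rw [hY _ (hw t)]
    have h1 : |w t / m - w s / m| ≤ ρ / 4 := by
      rw [← sub_div, abs_div, abs_of_pos hm, ← hmρ, abs_sub_comm]
      exact div_le_div_of_nonneg_right ((hwlip s t).trans hst) hm.le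
    linarith [abs_sub_le (w t / m) (w s / m) (q y)]
  let clamp : ℝ → ℝ := fun t => max (2 * c) (min t (1 - 2 * c))
  have hclamp : ∀ t, 2 * c ≤ clamp t ∧ clamp t ≤ 1 - 2 * c := fun t =>
    ⟨le_max_left _ _, max_le (by linarith) (min_le_right _ _)⟩
  have hclamp' : ∀ t t', |clamp t - clamp t'| ≤ |t - t'| := fun t t' => by
    calc _ ≤ |min t (1 - 2 * c) - min t' (1 - 2 * c)| := by
          simpa using abs_max_sub_max_le_max (2 * c) (min t (1 - 2 * c)) (2 * c) (min t' (1 - 2 * c))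
      _ ≤ |t - t'| := by simpa using abs_min_sub_min_le_max t (1 - 2 * c) t' (1 - 2 * c)
  have hclamp'' : ∀ y, |clamp (p y) - p y| ≤ 2 * c := fun y => by
    have := hp01 y
    simp only [clamp]
    rcases le_total (p y) (1 - 2 * c) with h | h
    · rw [min_eq_left h]
      rcases le_total (2 * c) (p y) with h' | h'
      · rw [max_eq_right h', sub_self, abs_zero]; linarith
      · rw [max_eq_left h', abs_le]; constructor <;> linarith [this.1]
    · rw [min_eq_right h, max_eq_right (by linarith), abs_le]; constructor <;> linarith [this.2]
  set k := ⌈S⌉₊ with hk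
  have hSk : S ≤ k := Nat.le_ceil S
  let u : ℕ → ℝ := fun i =>
    if i = 0 then c else if i = k + 2 then 1 - c else clamp (p (Y (w ((i : ℝ) - 1))))
  have u0 : u 0 = c := by simp [u]
  have u1 : u (k + 2) = 1 - c := by simp [u]
  have u2 : ∀ i ≤ k, u (i + 1) = clamp (p (Y (w i))) := fun i hi => by
    have : i ≠ k + 1 := by omega
    simp [u, this]
  have hu : ∀ i < k + 2, |u i - u (i + 1)| ≤ c := by
    intro i hi
    obtain rfl | ⟨i, rfl⟩ : i = 0 ∨ ∃ j, i = j + 1 := by cases i <;> simp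
    · have h1 := abs_lt.mp (hYq y₀)
      rw [u0, u2 0 (Nat.zero_le _), Nat.cast_zero, hwa 0 le_rfl]
      have : clamp (p (Y (m * q y₀))) = 2 * c := max_eq_left ((min_le_left _ _).trans (by linarith))
      rw [this, abs_le]
      constructor <;> linarith
    · rcases eq_or_ne i k with rfl | hik
      · have h1 := abs_lt.mp (hYq y₁)
        rw [u1, u2 _ le_rfl, hwb _ hSk]
        have : clamp (p (Y (m * q y₁))) = 1 - 2 * c := by
          simp only [clamp]
          rw [min_eq_right (by linarith), max_eq_right (by linarith)]
        rw [this, abs_le]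
        constructor <;> linarith
      · rw [u2 i (by omega), u2 (i + 1) (by omega)]
        refine (hclamp' _ _).trans ?_
        rw [abs_sub_comm]
        refine (hpq _ _ ?_).le
        rw [hY _ (hw _), hY _ (hw _), ← sub_div, abs_div, abs_of_pos hm]
        have h1 : |w ((i + 1 : ℕ) : ℝ) - w i| ≤ 1 := (hwlip _ _).trans (by simp)
        have h2 := div_le_div_of_nonneg_right h1 hm.le
        linarith
  obtain ⟨h, hh, hnear⟩ := exists_lift_walk hX hs hf hc (by linarith)
    (fun x => by rw [u0]; linarith [(hf01 x).1]) (fun x => by rw [u1]; linarith [(hf01 x).2]) hu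
  have hlift : ∀ x, ∃ t, |h x - 1 - t| ≤ 1 ∧ |p (Y (w t)) - f x| < 4 * c := by
    intro x
    obtain ⟨i, hi, h1, h2⟩ := hnear x
    have e1 := abs_le.mp h1
    have e2 := abs_lt.mp h2
    refine ⟨i - 1, by rwa [sub_sub_sub_cancel_right], ?_⟩
    rw [abs_lt]
    obtain rfl | ⟨i, rfl⟩ : i = 0 ∨ ∃ j, i = j + 1 := by cases i <;> simp
    · have h3 := abs_lt.mp (hYq y₀)
      rw [hwa _ (by norm_num)]
      rw [u0] at e2
      constructor <;> linarith
    · rw [Nat.cast_add_one, add_sub_cancel_right]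
      rcases eq_or_ne i (k + 1) with rfl | hik
      · have h3 := abs_lt.mp (hYq y₁)
        rw [hwb _ (by push_cast; linarith)]
        rw [u1] at e2
        constructor <;> linarith
      · rw [u2 i (by omega)] at e2
        have h3 := abs_le.mp (hclamp'' (Y (w i)))
        constructor <;> linarith
  have hlow : ∃ x, h x ≤ 1 := by
    obtain ⟨x, hx⟩ : (0 : ℝ) ∈ range f := hf' ▸ ⟨le_rfl, zero_le_one⟩
    obtain ⟨i, hi, h1, h2⟩ := hnear x
    have e1 := abs_le.mp h1
    have e2 := abs_lt.mp h2
    refine ⟨x, ?_⟩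
    obtain rfl | ⟨i, rfl⟩ : i = 0 ∨ ∃ j, i = j + 1 := by cases i <;> simp
    · push_cast at e1; linarith
    · rcases eq_or_ne i (k + 1) with rfl | hik
      · rw [u1] at e2; linarith
      · rw [u2 i (by omega)] at e2
        linarith [hclamp (p (Y (w i)))]
  have hup : ∃ x, k + 1 ≤ h x := by
    obtain ⟨x, hx⟩ : (1 : ℝ) ∈ range f := hf' ▸ ⟨zero_le_one, le_rfl⟩
    obtain ⟨i, hi, h1, h2⟩ := hnear x
    have e1 := abs_le.mp h1
    have e2 := abs_lt.mp h2
    refine ⟨x, ?_⟩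
    obtain rfl | ⟨i, rfl⟩ : i = 0 ∨ ∃ j, i = j + 1 := by cases i <;> simp
    · rw [u0] at e2; linarith
    · rcases eq_or_ne i (k + 1) with rfl | hik
      · push_cast at e1; linarith
      · rw [u2 i (by omega)] at e2
        linarith [hclamp (p (Y (w i)))]
  obtain ⟨x₀, hx₀⟩ := hlow
  obtain ⟨x₁, hx₁⟩ := hup
  have hcov : ∀ s ∈ Icc 0 S, ∃ x, h x - 1 = s := fun s hs => by
    obtain ⟨x, hx⟩ := intermediate_value_univ x₀ x₁ hh
      (show s + 1 ∈ Icc (h x₀) (h x₁) from ⟨by linarith [hs.1], by linarith [hs.2]⟩)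
    exact ⟨x, by linarith⟩
  have hg : Continuous fun x => w (h x - 1) / m :=
    (hwcont.comp (hh.sub continuous_const)).div_const m
  have hrange : range (fun x => w (h x - 1) / m) = Icc 0 1 := by
    refine Subset.antisymm ?_ ?_
    · rintro _ ⟨x, rfl⟩
      exact ⟨div_nonneg (hw _).1 hm.le, (div_le_one hm).mpr (hw _).2⟩
    · obtain ⟨a, ha⟩ := hcov s₀ hs₀
      obtain ⟨b, hb⟩ := hcov s₁ hs₁
      refine Subset.trans ?_ (intermediate_value_univ a b hg)
      rw [ha, hb, hws₀, hws₁, zero_div, div_self hm.ne']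
  refine ⟨fun x => w (h x - 1) / m, q, ρ / 4, hg, hq, hrange, hq', by positivity, ?_, ?_⟩
  · intro x y hxy
    obtain ⟨t, ht, htx⟩ := hlift x
    have h1 := hstep _ t y ht hxy
    rw [abs_sub_comm] at htx
    linarith [abs_sub_le (f x) (p (Y (w t))) (p y)]
  · intro y y' hyy
    exact (hρq y y' (by linarith)).trans_le (min_le_right _ _)

/-! ### Uniqueness of arc-like hereditarily indecomposable continua -/

/-- A relation of the form `|f x - p y| ≤ r` for maps `f` and `p` onto the unit interval. -/
def IsIntervalRelation {X P : Type*} [TopologicalSpace X] [TopologicalSpace P]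
    (R : Set (X × P)) : Prop :=
  ∃ (f : X → ℝ) (p : P → ℝ) (r : ℝ), Continuous f ∧ Continuous p ∧ range f = Icc 0 1 ∧
    range p = Icc 0 1 ∧ 0 < r ∧ R = {z | |f z.1 - p z.2| ≤ r}

section IsIntervalRelation

variable {X P : Type*} [TopologicalSpace X] [TopologicalSpace P] {R : Set (X × P)}

theorem IsIntervalRelation.isClosed (h : IsIntervalRelation R) : IsClosed R := by
  obtain ⟨f, p, r, hf, hp, -, -, -, rfl⟩ := h
  exact isClosed_le ((hf.comp continuous_fst).sub (hp.comp continuous_snd)).abs continuous_const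

theorem IsIntervalRelation.exists_right (h : IsIntervalRelation R) (x : X) : ∃ y, (x, y) ∈ R := by
  obtain ⟨f, p, r, -, -, hf, hp, hr, rfl⟩ := h
  obtain ⟨y, hy⟩ : f x ∈ range p := hp ▸ hf ▸ mem_range_self x
  exact ⟨y, by simp [hy, hr.le]⟩

theorem IsIntervalRelation.preimage_swap (h : IsIntervalRelation R) :
    IsIntervalRelation (Prod.swap ⁻¹' R) := by
  obtain ⟨f, p, r, hf, hp, hf', hp', hr, rfl⟩ := h
  refine ⟨p, f, r, hp, hf, hp', hf', hr, ?_⟩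
  ext z
  simp [abs_sub_comm]

end IsIntervalRelation

theorem exists_forall_mem_of_antitone {X P : Type*} [TopologicalSpace X] [TopologicalSpace P]
    [CompactSpace P]
    {R : ℕ → Set (X × P)} (hR : ∀ n, IsIntervalRelation (R n)) (hanti : Antitone R)
    (x : X) : ∃ y, ∀ n, (x, y) ∈ R n := by
  have hc : Continuous fun y : P => (x, y) := by fun_prop
  obtain ⟨y, hy⟩ := IsCompact.nonempty_iInter_of_sequence_nonempty_isCompact_isClosed
    (fun n => (fun y : P => (x, y)) ⁻¹' R n) (fun n y hy => hanti n.le_succ hy)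
    (fun n => (hR n).exists_right x) ((hR 0).isClosed.preimage hc).isCompact
    fun n => (hR n).isClosed.preimage hc
  exact ⟨y, fun n => mem_iInter.mp hy n⟩

theorem eq_of_forall_dist_lt_one_div {Y : Type*} [MetricSpace Y] {a b : Y}
    (h : ∀ n : ℕ, dist a b < 1 / ((n : ℝ) + 1)) : a = b := by
  by_contra hne
  obtain ⟨n, hn⟩ := exists_nat_one_div_lt (dist_pos.mpr hne)
  exact (h n).not_gt hn

section refinement

variable {X P : Type*} [MetricSpace X] [CompactSpace X] [ConnectedSpace X]
  [MetricSpace P] [CompactSpace P]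

theorem IsIntervalRelation.exists_subset_dist_right_lt (hX : HereditarilyIndecomposable X)
    (hs : SpanZero X) (hP : ArcLike P) {R : Set (X × P)} (hR : IsIntervalRelation R) {ε : ℝ}
    (hε : 0 < ε) : ∃ R' ⊆ R, IsIntervalRelation R' ∧
      ∀ x y y', (x, y) ∈ R' → (x, y') ∈ R' → dist y y' < ε := by
  obtain ⟨f, p, r, hf, hp, hf', hp', hr, rfl⟩ := hR
  obtain ⟨g, q, s, hg, hq, hg', hq', hs, hsub, hfib⟩ :=
    exists_refinement hX hs hP hf hp hf' hp' hr hε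
  refine ⟨_, fun z hz => hsub z.1 z.2 hz, ⟨g, q, s, hg, hq, hg', hq', hs, rfl⟩,
    fun x y y' h h' => hfib y y' ?_⟩
  have h1 := abs_sub_le (q y) (g x) (q y')
  rw [abs_sub_comm (q y) (g x)] at h1
  have h2 : |g x - q y| ≤ s := h
  have h3 : |g x - q y'| ≤ s := h'
  linarith

theorem IsIntervalRelation.exists_subset_dist_lt [ConnectedSpace P]
    (hX : HereditarilyIndecomposable X) (hX' : ArcLike X) (hP : HereditarilyIndecomposable P)
    (hP' : ArcLike P) {R : Set (X × P)} (hR : IsIntervalRelation R) {ε : ℝ} (hε : 0 < ε) :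
    ∃ R' ⊆ R, IsIntervalRelation R' ∧
      (∀ x y y', (x, y) ∈ R' → (x, y') ∈ R' → dist y y' < ε) ∧
      ∀ x x' y, (x, y) ∈ R' → (x', y) ∈ R' → dist x x' < ε := by
  obtain ⟨R₁, h1, hR₁, hd⟩ := hR.exists_subset_dist_right_lt hX hX'.spanZero hP' hε
  obtain ⟨R₂, h2, hR₂, hd'⟩ :=
    hR₁.preimage_swap.exists_subset_dist_right_lt hP hP'.spanZero hX' hε
  refine ⟨Prod.swap ⁻¹' R₂, fun z hz => h1 (h2 hz), hR₂.preimage_swap, fun x y y' h h' =>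
    hd x y y' (h2 h) (h2 h'), fun x x' y h h' => hd' y x x' h h'⟩

/-- Bing's theorem: hereditarily indecomposable arc-like continua are homeomorphic. -/
theorem ArcLike.nonempty_homeomorph [ConnectedSpace P]
    (hX : HereditarilyIndecomposable X) (hX' : ArcLike X) (hP : HereditarilyIndecomposable P)
    (hP' : ArcLike P) : Nonempty (X ≃ₜ P) := by
  obtain ⟨f, hf, hf', -⟩ := hX'.exists_map_dist_lt one_pos
  obtain ⟨p, hp, hp', -⟩ := hP'.exists_map_dist_lt one_pos
  have h0 : IsIntervalRelation {z : X × P | |f z.1 - p z.2| ≤ 1} :=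
    ⟨f, p, 1, hf, hp, hf', hp', one_pos, rfl⟩
  choose! next hsub hnext hright hleft using fun (R : Set (X × P)) (hR : IsIntervalRelation R)
    (n : ℕ) => hR.exists_subset_dist_lt hX hX' hP hP' (Nat.one_div_pos_of_nat (n := n) (α := ℝ))
  let R : ℕ → Set (X × P) := fun n =>
    Nat.rec {z : X × P | |f z.1 - p z.2| ≤ 1} (fun n R => next R n) n
  have hR : ∀ n, IsIntervalRelation (R n) := fun n => by
    induction n with
    | zero => exact h0
    | succ n ih => exact hnext _ ih n
  have hanti : Antitone R := antitone_nat_of_succ_le fun n => hsub _ (hR n) n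
  let G : Set (X × P) := ⋂ n, R n
  have hG : IsCompact G := (isClosed_iInter fun n => (hR n).isClosed).isCompact
  have : CompactSpace G := isCompact_iff_compactSpace.mp hG
  have hfst : Function.Bijective fun z : G => z.1.1 := by
    constructor
    · rintro ⟨⟨x, y⟩, hz⟩ ⟨⟨x', y'⟩, hz'⟩ (rfl : x = x')
      have : y = y' := eq_of_forall_dist_lt_one_div fun n =>
        hright _ (hR n) n x y y' (mem_iInter.mp hz (n + 1)) (mem_iInter.mp hz' (n + 1))
      subst this
      rfl
    · intro x
      obtain ⟨y, hy⟩ := exists_forall_mem_of_antitone hR hanti x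
      exact ⟨⟨(x, y), mem_iInter.mpr hy⟩, rfl⟩
  have hsnd : Function.Bijective fun z : G => z.1.2 := by
    constructor
    · rintro ⟨⟨x, y⟩, hz⟩ ⟨⟨x', y'⟩, hz'⟩ (rfl : y = y')
      have : x = x' := eq_of_forall_dist_lt_one_div fun n =>
        hleft _ (hR n) n x x' y (mem_iInter.mp hz (n + 1)) (mem_iInter.mp hz' (n + 1))
      subst this
      rfl
    · intro y
      obtain ⟨x, hx⟩ := exists_forall_mem_of_antitone (fun n => (hR n).preimage_swap)
        (fun m n hmn z hz => hanti hmn hz) y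
      exact ⟨⟨(x, y), mem_iInter.mpr hx⟩, rfl⟩
  have e1 : G ≃ₜ X := Continuous.homeoOfEquivCompactToT2 (f := Equiv.ofBijective _ hfst)
    (continuous_fst.comp continuous_subtype_val)
  have e2 : G ≃ₜ P := Continuous.homeoOfEquivCompactToT2 (f := Equiv.ofBijective _ hsnd)
    (continuous_snd.comp continuous_subtype_val)
  exact ⟨e1.symm.trans e2⟩

end refinement

/-- a continuum is homeomorphic to the pseudo-arc (the hereditarily
indecomposable arc-like continuum) iff it is hereditarily indecomposable with span zero. -/
theorem stmt16 (X : Type*) [MetricSpace X] [CompactSpace X] [ConnectedSpace X] [Nontrivial X]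
    (P : Type*) [MetricSpace P] [CompactSpace P] [ConnectedSpace P] [Nontrivial P]
    (hP : HereditarilyIndecomposable P ∧ ArcLike P) :
    Nonempty (X ≃ₜ P) ↔ (HereditarilyIndecomposable X ∧ SpanZero X) := by
  constructor
  · rintro ⟨e⟩
    exact ⟨hP.1.of_homeomorph e, hP.2.spanZero.of_homeomorph e⟩
  · rintro ⟨hX, hs⟩
    exact (arcLike_of_spanZero hX hs).nonempty_homeomorph hX hP.1 hP.2
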